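/- r-th level scaled-cancellation recursion for the first T-sequence: in the r-th level interpolating setup with p₀ > p₁ > … > p_r > 0 strictly decreasing, for every k₁ ∈ {1,…,r}: Σ_{i₁=1}^{l} Σ_{i₂=1}^{l} Σ_{j=1}^{m} β_{i₁} (√(1−t)/√(p_{k₁}−p_{k₁+1})) T^p_{k₁+1,1,j}(i₁,i₂) = Σ_{i₁=1}^{l} Σ_{i₂=1}^{l} Σ_{j=1}^{m} β_{i₁} (√(1−t)/√(p_{k₁−1}−p_{k₁})) T^p_{k₁,1,j}(i₁,i₂) − (1−t) s β² (𝔪_{k₁} − 𝔪_{k₁+1}) E_{G,𝒰_{r+1}}⟨‖x^{(i₁)}‖₂‖x^{(p₁)}‖₂ (y^{(p₂)})ᵀy^{(i₂)}⟩_{γ_{k₁+1}^{(r)}}. -/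

import Mathlib

set_option linter.unusedVariables false

open MeasureTheory Real

namespace SFLR

noncomputable section

/-- The sample space of one group `𝒰_k = (u^{(4,k)}, u^{(2,k)}, h^{(k)})`. -/
abbrev Us (m n : ℕ) : Type := ℝ × (Fin m → ℝ) × (Fin n → ℝ)

/-- Standard Gaussian measure on `ℝ`. -/
def stdG : Measure ℝ := ProbabilityTheory.gaussianReal 0 1

/-- i.i.d. standard Gaussian vector measure. -/
def gVec (d : ℕ) : Measure (Fin d → ℝ) := Measure.pi fun _ => stdG

/-- i.i.d. standard Gaussian matrix measure. -/
def gMat (m n : ℕ) : Measure (Fin m → Fin n → ℝ) := Measure.pi fun _ => gVec n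

/-- Law of one group `𝒰_k`. -/
def muU (m n : ℕ) : Measure (Us m n) := stdG.prod ((gVec m).prod (gVec n))

/-- Joint law of `(G, (𝒰_k)_{k=1}^{r+1})`; the `k`-th group `𝒰_k` is coordinate `k-1`. -/
def muAll (r m n : ℕ) : Measure ((Fin m → Fin n → ℝ) × (Fin (r+1) → Us m n)) :=
  (gMat m n).prod (Measure.pi fun _ : Fin (r+1) => muU m n)

/-- Euclidean norm. -/
def nrm2 {d : ℕ} (v : Fin d → ℝ) : ℝ := Real.sqrt (∑ i, v i ^ 2)

/-- Euclidean inner product. -/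
def dotv {d : ℕ} (a b : Fin d → ℝ) : ℝ := ∑ i, a i * b i

variable {m n l : ℕ}

/-- The `r`-th level interpolating exponent `D₀^{(i₁,i₂)}`; the factor `ε` multiplies the
`u^{(4,k)}`-terms (`ε = 1` gives `D₀`, `ε = 0` gives `D_{0,S}`). -/
def D0R (r : ℕ) (ε β s t : ℝ) (mv p q : ℕ → ℝ) (x : Fin l → Fin n → ℝ) (y : Fin l → Fin m → ℝ)
    (G : Fin m → Fin n → ℝ) (U : Fin (r+1) → Us m n) (i1 i2 : Fin l) : ℝ :=
  Real.sqrt t * (∑ j, ∑ k, y i2 j * (G j k * x i1 k))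
    + Real.sqrt (1 - t) * nrm2 (x i1) *
        (∑ j, y i2 j * (∑ k : Fin (r+1), Real.sqrt (p (k : ℕ) - p ((k : ℕ) + 1)) * (U k).2.1 j))
    + ε * (Real.sqrt t * nrm2 (x i1) * nrm2 (y i2) *
        (∑ k : Fin (r+1),
          Real.sqrt (p (k : ℕ) * q (k : ℕ) - p ((k : ℕ) + 1) * q ((k : ℕ) + 1)) * (U k).1))
    + Real.sqrt (1 - t) * nrm2 (y i2) *
        (∑ kk, (∑ k : Fin (r+1), Real.sqrt (q (k : ℕ) - q ((k : ℕ) + 1)) * (U k).2.2 kk) * x i1 kk)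

/-- `A^{(i₁,i₂)}`. -/
def AR (r : ℕ) (ε β s t : ℝ) (mv p q : ℕ → ℝ) (x : Fin l → Fin n → ℝ) (y : Fin l → Fin m → ℝ)
    (G : Fin m → Fin n → ℝ) (U : Fin (r+1) → Us m n) (i1 i2 : Fin l) : ℝ :=
  Real.exp (β * D0R r ε β s t mv p q x y G U i1 i2)

/-- `C^{(i₁)}`. -/
def CR (r : ℕ) (ε β s t : ℝ) (mv p q : ℕ → ℝ) (x : Fin l → Fin n → ℝ) (y : Fin l → Fin m → ℝ)
    (G : Fin m → Fin n → ℝ) (U : Fin (r+1) → Us m n) (i1 : Fin l) : ℝ :=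
  ∑ i2, AR r ε β s t mv p q x y G U i1 i2

/-- `Z`. -/
def ZR (r : ℕ) (ε β s t : ℝ) (mv p q : ℕ → ℝ) (x : Fin l → Fin n → ℝ) (y : Fin l → Fin m → ℝ)
    (G : Fin m → Fin n → ℝ) (U : Fin (r+1) → Us m n) : ℝ :=
  ∑ i1, CR r ε β s t mv p q x y G U i1 ^ s

/-- `ζ_k`: successively integrated partition functions, `ζ₀ = Z`,
`ζ_k = E_{𝒰_k} ζ_{k-1}^{𝔪_k/𝔪_{k-1}}`. -/
def zetaR (r : ℕ) (ε β s t : ℝ) (mv p q : ℕ → ℝ) (x : Fin l → Fin n → ℝ)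
    (y : Fin l → Fin m → ℝ) (G : Fin m → Fin n → ℝ) : ℕ → (Fin (r+1) → Us m n) → ℝ
  | 0, U => ZR r ε β s t mv p q x y G U
  | k+1, U =>
      if h : k < r + 1 then
        ∫ u, zetaR r ε β s t mv p q x y G k (Function.update U ⟨k, h⟩ u) ^ (mv (k+1) / mv k)
          ∂ muU m n
      else 0

/-- The `r`-th level interpolating function `ψ`. -/
def psiR (r : ℕ) (ε β s t : ℝ) (mv p q : ℕ → ℝ) (x : Fin l → Fin n → ℝ)
    (y : Fin l → Fin m → ℝ) : ℝ :=
  ∫ ω, (β * |s| * Real.sqrt (n : ℝ) * mv r)⁻¹ *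
      Real.log (zetaR r ε β s t mv p q x y ω.1 r ω.2) ∂ muAll r m n

/-- The operator `Φ_{𝒰_k}` (for `k ≥ 1`). -/
def PhiR (r : ℕ) (ε β s t : ℝ) (mv p q : ℕ → ℝ) (x : Fin l → Fin n → ℝ)
    (y : Fin l → Fin m → ℝ) (k : ℕ)
    (f : (Fin m → Fin n → ℝ) → (Fin (r+1) → Us m n) → ℝ) :
    (Fin m → Fin n → ℝ) → (Fin (r+1) → Us m n) → ℝ :=
  fun G U =>
    if h : k - 1 < r + 1 then
      (∫ u, zetaR r ε β s t mv p q x y G (k-1) (Function.update U ⟨k-1, h⟩ u) ^ (mv k / mv (k-1))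
          * f G (Function.update U ⟨k-1, h⟩ u) ∂ muU m n) /
        zetaR r ε β s t mv p q x y G k U
    else 0

/-- `Φ_{𝒰_hi} ∘ ⋯ ∘ Φ_{𝒰_lo}` (identity when `hi < lo`). -/
def PhiUpToR (r : ℕ) (ε β s t : ℝ) (mv p q : ℕ → ℝ) (x : Fin l → Fin n → ℝ)
    (y : Fin l → Fin m → ℝ) (lo : ℕ) :
    ℕ → ((Fin m → Fin n → ℝ) → (Fin (r+1) → Us m n) → ℝ) →
      (Fin m → Fin n → ℝ) → (Fin (r+1) → Us m n) → ℝ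
  | 0, f => f
  | hi+1, f =>
      if hi + 1 < lo then f
      else PhiR r ε β s t mv p q x y (hi+1) (PhiUpToR r ε β s t mv p q x y lo hi f)

/-- `γ₀(i₁,i₂)`. -/
def gam0R (r : ℕ) (ε β s t : ℝ) (mv p q : ℕ → ℝ) (x : Fin l → Fin n → ℝ)
    (y : Fin l → Fin m → ℝ) (i1 i2 : Fin l) :
    (Fin m → Fin n → ℝ) → (Fin (r+1) → Us m n) → ℝ :=
  fun G U =>
    CR r ε β s t mv p q x y G U i1 ^ s / ZR r ε β s t mv p q x y G U *
      (AR r ε β s t mv p q x y G U i1 i2 / CR r ε β s t mv p q x y G U i1)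

/-- The measure `γ_{k₁+1}^{(r)}`. -/
def gamR (r : ℕ) (ε β s t : ℝ) (mv p q : ℕ → ℝ) (x : Fin l → Fin n → ℝ)
    (y : Fin l → Fin m → ℝ) (k1 : ℕ) (i1 i2 pp1 pp2 : Fin l) :
    (Fin m → Fin n → ℝ) → (Fin (r+1) → Us m n) → ℝ :=
  PhiUpToR r ε β s t mv p q x y (k1+1) r
    (fun G U =>
      PhiUpToR r ε β s t mv p q x y 1 k1 (gam0R r ε β s t mv p q x y i1 i2) G U *
        PhiUpToR r ε β s t mv p q x y 1 k1 (gam0R r ε β s t mv p q x y pp1 pp2) G U)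

/-- The measure `γ₀₁^{(r)}`. -/
def gam01R (r : ℕ) (ε β s t : ℝ) (mv p q : ℕ → ℝ) (x : Fin l → Fin n → ℝ)
    (y : Fin l → Fin m → ℝ) (i1 i2 : Fin l) :
    (Fin m → Fin n → ℝ) → (Fin (r+1) → Us m n) → ℝ :=
  PhiUpToR r ε β s t mv p q x y 1 r (gam0R r ε β s t mv p q x y i1 i2)

/-- The measure `γ₀₂^{(r)}`. -/
def gam02R (r : ℕ) (ε β s t : ℝ) (mv p q : ℕ → ℝ) (x : Fin l → Fin n → ℝ)
    (y : Fin l → Fin m → ℝ) (i1 i2 p2 : Fin l) :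
    (Fin m → Fin n → ℝ) → (Fin (r+1) → Us m n) → ℝ :=
  PhiUpToR r ε β s t mv p q x y 1 r
    (fun G U =>
      gam0R r ε β s t mv p q x y i1 i2 G U * gam0R r ε β s t mv p q x y i1 p2 G U)

/-- `E_{G,𝒰_{r+1}} ⟨f⟩_{γ_{k₁+1}^{(r)}}`. -/
def EBrR (r : ℕ) (ε β s t : ℝ) (mv p q : ℕ → ℝ) (x : Fin l → Fin n → ℝ)
    (y : Fin l → Fin m → ℝ) (k1 : ℕ) (f : Fin l → Fin l → Fin l → Fin l → ℝ) : ℝ :=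
  ∫ ω, (∑ i1, ∑ i2, ∑ pp1, ∑ pp2,
      f i1 i2 pp1 pp2 * gamR r ε β s t mv p q x y k1 i1 i2 pp1 pp2 ω.1 ω.2) ∂ muAll r m n

/-- `E_{G,𝒰_{r+1}} ⟨f⟩_{γ₀₁^{(r)}}`. -/
def EB01R (r : ℕ) (ε β s t : ℝ) (mv p q : ℕ → ℝ) (x : Fin l → Fin n → ℝ)
    (y : Fin l → Fin m → ℝ) (f : Fin l → Fin l → ℝ) : ℝ :=
  ∫ ω, (∑ i1, ∑ i2, f i1 i2 * gam01R r ε β s t mv p q x y i1 i2 ω.1 ω.2) ∂ muAll r m n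

/-- `E_{G,𝒰_{r+1}} ⟨f⟩_{γ₀₂^{(r)}}`. -/
def EB02R (r : ℕ) (ε β s t : ℝ) (mv p q : ℕ → ℝ) (x : Fin l → Fin n → ℝ)
    (y : Fin l → Fin m → ℝ) (f : Fin l → Fin l → Fin l → ℝ) : ℝ :=
  ∫ ω, (∑ i1, ∑ i2, ∑ p2, f i1 i2 p2 * gam02R r ε β s t mv p q x y i1 i2 p2 ω.1 ω.2)
    ∂ muAll r m n

/-- `E_{G,𝒰_{r+1}} ⟨‖x^{(i₁)}‖‖x^{(p₁)}‖‖y^{(i₂)}‖‖y^{(p₂)}‖⟩_{γ_{k₁+1}^{(r)}}`. -/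
def EXR (r : ℕ) (ε β s t : ℝ) (mv p q : ℕ → ℝ) (x : Fin l → Fin n → ℝ)
    (y : Fin l → Fin m → ℝ) (k1 : ℕ) : ℝ :=
  EBrR r ε β s t mv p q x y k1
    (fun i1 i2 pp1 pp2 => nrm2 (x i1) * nrm2 (x pp1) * nrm2 (y i2) * nrm2 (y pp2))

/-- The corrected interpolating function `ψ₁`. -/
def psi1R (r : ℕ) (ε β s t : ℝ) (mv p q : ℕ → ℝ) (x : Fin l → Fin n → ℝ)
    (y : Fin l → Fin m → ℝ) : ℝ :=
  -(Real.sign s * s * β / (2 * Real.sqrt (n : ℝ))) *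
      (∑ k ∈ Finset.range (r+1),
        mv (k+1) * (p k * q k * EXR r ε β s t mv p q x y k
          - p (k+1) * q (k+1) * EXR r ε β s t mv p q x y (k+1)))
    + psiR r ε β s t mv p q x y

/-- The component `u_j^{(2,k)}`. -/
def u2c {r m n : ℕ} (U : Fin (r+1) → Us m n) (k : ℕ) (j : Fin m) : ℝ :=
  if h : k - 1 < r + 1 then (U ⟨k-1, h⟩).2.1 j else 0

/-- The scalar `u^{(4,k)}`. -/
def u4c {r m n : ℕ} (U : Fin (r+1) → Us m n) (k : ℕ) : ℝ :=
  if h : k - 1 < r + 1 then (U ⟨k-1, h⟩).1 else 0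

/-- `u^{(i₁,3,k)} = (h^{(k)})ᵀ x^{(i₁)} / ‖x^{(i₁)}‖₂`. -/
def u3c {r m n l : ℕ} (x : Fin l → Fin n → ℝ) (U : Fin (r+1) → Us m n) (k : ℕ)
    (i1 : Fin l) : ℝ :=
  if h : k - 1 < r + 1 then dotv (U ⟨k-1, h⟩).2.2 (x i1) / nrm2 (x i1) else 0

/-- The nested conditional expectations
`E_{𝒰_v}(ζ_{v-1}^{𝔪_v/𝔪_{v-1}-1} ⋯ E_{𝒰₁}(ζ₀^{𝔪₁/𝔪₀-1} g) ⋯)`. -/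
def nestR (r : ℕ) (ε β s t : ℝ) (mv p q : ℕ → ℝ) (x : Fin l → Fin n → ℝ)
    (y : Fin l → Fin m → ℝ) (g : (Fin m → Fin n → ℝ) → (Fin (r+1) → Us m n) → ℝ) :
    ℕ → (Fin m → Fin n → ℝ) → (Fin (r+1) → Us m n) → ℝ
  | 0 => g
  | v+1 => fun G U =>
      if h : v < r + 1 then
        ∫ u, zetaR r ε β s t mv p q x y G v (Function.update U ⟨v, h⟩ u) ^
              (mv (v+1) / mv v - 1) *
            nestR r ε β s t mv p q x y g v G (Function.update U ⟨v, h⟩ u) ∂ muU m n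
      else 0

/-- `T^p_{k,1,j}(i₁,i₂)` at the `r`-th level. -/
def TpR (r : ℕ) (ε β s t : ℝ) (mv p q : ℕ → ℝ) (x : Fin l → Fin n → ℝ)
    (y : Fin l → Fin m → ℝ) (k : ℕ) (j : Fin m) (i1 i2 : Fin l) : ℝ :=
  ∫ ω, (zetaR r ε β s t mv p q x y ω.1 r ω.2)⁻¹ *
      nestR r ε β s t mv p q x y
        (fun G U => CR r ε β s t mv p q x y G U i1 ^ (s - 1) *
          AR r ε β s t mv p q x y G U i1 i2 * y i2 j * u2c U k j) r ω.1 ω.2 ∂ muAll r m n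

/-- `T^q_{k,2}(i₁,i₂)` at the `r`-th level. -/
def TqR (r : ℕ) (ε β s t : ℝ) (mv p q : ℕ → ℝ) (x : Fin l → Fin n → ℝ)
    (y : Fin l → Fin m → ℝ) (k : ℕ) (i1 i2 : Fin l) : ℝ :=
  ∫ ω, (zetaR r ε β s t mv p q x y ω.1 r ω.2)⁻¹ *
      nestR r ε β s t mv p q x y
        (fun G U => CR r ε β s t mv p q x y G U i1 ^ (s - 1) *
          AR r ε β s t mv p q x y G U i1 i2 * u3c x U k i1) r ω.1 ω.2 ∂ muAll r m n

/-- `T^{(p,q)}_{k,3}(i₁,i₂)` at the `r`-th level. -/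
def TpqR (r : ℕ) (ε β s t : ℝ) (mv p q : ℕ → ℝ) (x : Fin l → Fin n → ℝ)
    (y : Fin l → Fin m → ℝ) (k : ℕ) (i1 i2 : Fin l) : ℝ :=
  ∫ ω, (zetaR r ε β s t mv p q x y ω.1 r ω.2)⁻¹ *
      nestR r ε β s t mv p q x y
        (fun G U => CR r ε β s t mv p q x y G U i1 ^ (s - 1) *
          AR r ε β s t mv p q x y G U i1 i2 * u4c U k) r ω.1 ω.2 ∂ muAll r m n


instance : IsProbabilityMeasure stdG := by unfold stdG; infer_instance
instance (d : ℕ) : IsProbabilityMeasure (gVec d) := by unfold gVec; infer_instance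
instance (m n : ℕ) : IsProbabilityMeasure (gMat m n) := by unfold gMat; infer_instance
instance (m n : ℕ) : IsProbabilityMeasure (muU m n) := by unfold muU; infer_instance
instance (r m n : ℕ) : IsProbabilityMeasure (muAll r m n) := by unfold muAll; infer_instance

/-- Integrability of all exponentials of the norm. -/
def ExpInt {X : Type*} [NormedAddCommGroup X] [MeasurableSpace X] (μ : Measure X) : Prop :=
  ∀ K : ℝ, 0 ≤ K → Integrable (fun x => Real.exp (K * ‖x‖)) μ

lemma expInt_stdG : ExpInt stdG := by
  intro K hK
  have h1 := ProbabilityTheory.integrable_exp_mul_gaussianReal (μ := 0) (v := 1) K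
  have h2 := ProbabilityTheory.integrable_exp_mul_gaussianReal (μ := 0) (v := 1) (-K)
  refine (h1.add h2).mono' (by fun_prop) (Filter.Eventually.of_forall fun x => ?_)
  simp only [Real.norm_eq_abs, Real.abs_exp, Pi.add_apply]
  rcases abs_cases x with ⟨h, _⟩ | ⟨h, _⟩ <;> rw [h]
  · have := Real.exp_pos (-K * x); linarith
  · have := Real.exp_pos (K * x)
    have h3 : K * -x = -K * x := by ring
    rw [h3]; linarith

lemma ExpInt.prod {X Y : Type*} [NormedAddCommGroup X] [MeasurableSpace X] [OpensMeasurableSpace X]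
    [NormedAddCommGroup Y] [MeasurableSpace Y] [OpensMeasurableSpace Y]
    {μ : Measure X} {ν : Measure Y} [SFinite μ] [SFinite ν]
    (hμ : ExpInt μ) (hν : ExpInt ν) : ExpInt (μ.prod ν) := by
  intro K hK
  refine ((hμ K hK).mul_prod (hν K hK)).mono' ?_ (Filter.Eventually.of_forall fun x => ?_)
  · apply Measurable.aestronglyMeasurable
    have h1 : Measurable fun z : X × Y => ‖z.1‖ := measurable_norm.comp measurable_fst
    have h2 : Measurable fun z : X × Y => ‖z.2‖ := measurable_norm.comp measurable_snd
    simp only [Prod.norm_def]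
    exact ((h1.max h2).const_mul K).exp
  · simp only [Real.norm_eq_abs, Real.abs_exp]
    rw [← Real.exp_add, ← mul_add]
    apply Real.exp_le_exp.2
    apply mul_le_mul_of_nonneg_left _ hK
    rw [Prod.norm_def]
    exact max_le_add_of_nonneg (norm_nonneg _) (norm_nonneg _)

lemma ExpInt.pi {ι : Type*} [Fintype ι] {X : Type*} [NormedAddCommGroup X] [MeasurableSpace X]
    [OpensMeasurableSpace X] [SecondCountableTopology X] {μ : Measure X} [SigmaFinite μ]
    (hμ : ExpInt μ) : ExpInt (Measure.pi fun _ : ι => μ) := by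
  intro K hK
  have h := Integrable.fintype_prod (μ := fun _ : ι => μ) (f := fun _ x => Real.exp (K * ‖x‖))
    (fun _ => hμ K hK)
  refine h.mono' ?_ (Filter.Eventually.of_forall fun x => ?_)
  · apply Measurable.aestronglyMeasurable
    exact (measurable_norm.const_mul K).exp
  · simp only [Real.norm_eq_abs, Real.abs_exp]
    rw [← Real.exp_sum, ← Finset.mul_sum]
    apply Real.exp_le_exp.2
    apply mul_le_mul_of_nonneg_left _ hK
    rw [pi_norm_le_iff_of_nonneg (Finset.sum_nonneg fun _ _ => norm_nonneg _)]
    exact fun i => Finset.single_le_sum (f := fun i => ‖x i‖) (fun _ _ => norm_nonneg _) (Finset.mem_univ i)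

lemma expInt_gVec (d : ℕ) : ExpInt (gVec d) := expInt_stdG.pi
lemma expInt_gMat (m n : ℕ) : ExpInt (gMat m n) := (expInt_gVec n).pi
lemma expInt_muU (m n : ℕ) : ExpInt (muU m n) :=
  expInt_stdG.prod ((expInt_gVec m).prod (expInt_gVec n))
lemma expInt_muAll (r m n : ℕ) : ExpInt (muAll r m n) :=
  (expInt_gMat m n).prod (expInt_muU m n).pi

lemma mp_update {ι : Type*} [Fintype ι] [DecidableEq ι] {X : Type*} [MeasurableSpace X]
    (μ : Measure X) [IsProbabilityMeasure μ] (k : ι) :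
    MeasurePreserving (fun z : (ι → X) × X => Function.update z.1 k z.2)
      ((Measure.pi fun _ : ι => μ).prod μ) (Measure.pi fun _ : ι => μ) := by
  refine ⟨measurable_update', ?_⟩
  symm
  apply Measure.pi_eq
  intro S hS
  rw [Measure.map_apply measurable_update' (MeasurableSet.univ_pi hS)]
  have : (fun z : (ι → X) × X => Function.update z.1 k z.2) ⁻¹' (Set.univ.pi S)
      = (Set.univ.pi (Function.update S k Set.univ)) ×ˢ (S k) := by
    ext z
    simp only [Set.mem_preimage, Set.mem_pi, Set.mem_univ, true_imp_iff, Set.mem_prod]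
    constructor
    · intro h
      refine ⟨fun i => ?_, by simpa using h k⟩
      by_cases hi : i = k
      · subst hi; simp
      · have := h i; simpa [hi] using this
    · rintro ⟨h1, h2⟩ i
      by_cases hi : i = k
      · subst hi; simpa using h2
      · have := h1 i; simpa [hi] using this
  rw [this, Measure.prod_prod, Measure.pi_pi, ← Finset.prod_erase_mul _ _ (Finset.mem_univ k),
    ← Finset.prod_erase_mul (a := k) Finset.univ (fun i => μ (S i)) (Finset.mem_univ k)]
  simp only [Function.update_self, measure_univ, mul_one]
  congr 1
  apply Finset.prod_congr rfl
  intro i hi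
  rw [Function.update_of_ne (Finset.ne_of_mem_erase hi)]

/-- One-dimensional Gaussian integration by parts. -/
lemma stein_one {f f' : ℝ → ℝ} (hd : ∀ x, HasDerivAt f (f' x) x) (hm : Measurable f')
    {C K : ℝ} (hK : 0 ≤ K)
    (hf : ∀ x, |f x| ≤ C * Real.exp (K * |x|)) (hf' : ∀ x, |f' x| ≤ C * Real.exp (K * |x|)) :
    ∫ x, x * f x ∂stdG = ∫ x, f' x ∂stdG := by
  have hfm : Measurable f :=
    (continuous_iff_continuousAt.2 fun x => (hd x).continuousAt).measurable
  have hC : 0 ≤ C := by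
    have := (abs_nonneg _).trans (hf 0)
    simpa using this
  have key : ∀ g : ℝ → ℝ, Integrable g stdG →
      Integrable (fun x => g x * ProbabilityTheory.gaussianPDFReal 0 1 x) volume := by
    intro g hg
    unfold stdG at hg
    rw [ProbabilityTheory.gaussianReal_of_var_ne_zero _ one_ne_zero,
      integrable_withDensity_iff_integrable_smul' (ProbabilityTheory.measurable_gaussianPDF _ _)
        (Filter.Eventually.of_forall fun x => ProbabilityTheory.gaussianPDF_lt_top)] at hg
    refine hg.congr (Filter.Eventually.of_forall fun x => ?_)
    simp [mul_comm]
  have i1 : Integrable f stdG := ((expInt_stdG K hK).const_mul C).mono' hfm.aestronglyMeasurable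
    (Filter.Eventually.of_forall fun x => by simpa using hf x)
  have i2 : Integrable f' stdG := ((expInt_stdG K hK).const_mul C).mono' hm.aestronglyMeasurable
    (Filter.Eventually.of_forall fun x => by simpa using hf' x)
  have i3 : Integrable (fun x => x * f x) stdG :=
    ((expInt_stdG (K+1) (by linarith)).const_mul C).mono'
      (measurable_id.mul hfm).aestronglyMeasurable
    (Filter.Eventually.of_forall fun x => by
      simp only [Real.norm_eq_abs, abs_mul]
      have h1 : |x| ≤ Real.exp |x| := by have := Real.add_one_le_exp |x|; linarith
      calc |x| * |f x| ≤ Real.exp |x| * (C * Real.exp (K * |x|)) :=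
            mul_le_mul h1 (hf x) (abs_nonneg _) (Real.exp_pos _).le
        _ = C * Real.exp ((K+1) * |x|) := by
            rw [add_mul, Real.exp_add, one_mul]; ring)
  have hpd : ∀ x, HasDerivAt (ProbabilityTheory.gaussianPDFReal 0 1)
      (-x * ProbabilityTheory.gaussianPDFReal 0 1 x) x := by
    intro x
    unfold ProbabilityTheory.gaussianPDFReal
    have h0 : HasDerivAt (fun x : ℝ => -(x - 0) ^ 2 / (2 * ((1 : NNReal) : ℝ))) (-x) x := by
      have := (((hasDerivAt_id x).sub_const 0).pow 2).neg.div_const (2 * ((1 : NNReal) : ℝ))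
      exact this.congr_deriv (by simp; ring)
    have := (h0.exp).const_mul ((√(2 * π * ((1 : NNReal) : ℝ)))⁻¹)
    exact this.congr_deriv (by ring)
  have e := integral_mul_deriv_eq_deriv_mul_of_integrable (u := f)
    (v := ProbabilityTheory.gaussianPDFReal 0 1) (u' := f')
    (v' := fun x => -x * ProbabilityTheory.gaussianPDFReal 0 1 x)
    (fun x _ => hd x) (fun x _ => hpd x)
    ((key _ i3).neg.congr (Filter.Eventually.of_forall fun x => by simp; ring))
    (key _ i2) (key _ i1)
  unfold stdG
  rw [ProbabilityTheory.integral_gaussianReal_eq_integral_smul one_ne_zero,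
    ProbabilityTheory.integral_gaussianReal_eq_integral_smul one_ne_zero]
  simp only [smul_eq_mul]
  have e1 : ∀ x : ℝ, ProbabilityTheory.gaussianPDFReal 0 1 x * (x * f x)
      = -(f x * (-x * ProbabilityTheory.gaussianPDFReal 0 1 x)) := fun x => by ring
  have e2 : ∀ x : ℝ, ProbabilityTheory.gaussianPDFReal 0 1 x * f' x
      = f' x * ProbabilityTheory.gaussianPDFReal 0 1 x := fun x => by ring
  simp only [e1, e2]
  rw [integral_neg, e, neg_neg]

/-- The full sample space. -/
abbrev Om (r m n : ℕ) : Type := (Fin m → Fin n → ℝ) × (Fin (r+1) → Us m n)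

section classes

variable {r : ℕ}

/-- Replace the group with index `v`. -/
def upd (ω : Om r m n) (v : Fin (r+1)) (u : Us m n) : Om r m n := (ω.1, Function.update ω.2 v u)

/-- Integrate out the group with index `v`. -/
def Iv (v : Fin (r+1)) (f : Om r m n → ℝ) : Om r m n → ℝ := fun ω => ∫ u, f (upd ω v u) ∂muU m n

lemma norm_upd_le (ω : Om r m n) (v : Fin (r+1)) (u : Us m n) : ‖upd ω v u‖ ≤ ‖ω‖ + ‖u‖ := by
  unfold upd
  rw [Prod.norm_def]
  apply max_le
  · have h1 : ‖ω.1‖ ≤ ‖ω‖ := norm_fst_le ω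
    have := norm_nonneg u
    simp only; linarith
  · simp only
    rw [pi_norm_le_iff_of_nonneg (by positivity)]
    intro i
    by_cases hi : i = v
    · subst hi; simp
    · rw [Function.update_of_ne hi]
      have h1 : ‖ω.2‖ ≤ ‖ω‖ := norm_snd_le ω
      have h2 : ‖ω.2 i‖ ≤ ‖ω.2‖ := norm_le_pi_norm _ _
      have := norm_nonneg u
      linarith

lemma measurable_upd (v : Fin (r+1)) :
    Measurable (fun z : Om r m n × Us m n => upd z.1 v z.2) := by
  unfold upd
  refine (measurable_fst.comp measurable_fst).prodMk ?_
  exact measurable_update'.comp ((measurable_snd.comp measurable_fst).prodMk measurable_snd)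

/-- Measurable with at most exponential growth. -/
def EG (f : Om r m n → ℝ) : Prop :=
  Measurable f ∧ ∃ C K : ℝ, 0 ≤ C ∧ 0 ≤ K ∧ ∀ ω, |f ω| ≤ C * Real.exp (K * ‖ω‖)

/-- Measurable, positive, with `log` of at most linear growth. -/
def PG (f : Om r m n → ℝ) : Prop :=
  Measurable f ∧ ∃ c K : ℝ, 0 ≤ c ∧ 0 ≤ K ∧ ∀ ω,
    Real.exp (-(c + K * ‖ω‖)) ≤ f ω ∧ f ω ≤ Real.exp (c + K * ‖ω‖)

lemma PG.pos {f : Om r m n → ℝ} (hf : PG f) (ω) : 0 < f ω := by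
  obtain ⟨_, c, K, _, _, h⟩ := hf
  exact (Real.exp_pos _).trans_le (h ω).1

lemma PG.eg {f : Om r m n → ℝ} (hf : PG f) : EG f := by
  have hp := hf.pos
  obtain ⟨hm, c, K, hc, hK, h⟩ := hf
  refine ⟨hm, Real.exp c, K, (Real.exp_pos _).le, hK, fun ω => ?_⟩
  rw [abs_of_pos (hp ω), ← Real.exp_add]
  exact (h ω).2

lemma PG.rpow {f : Om r m n → ℝ} (hf : PG f) (a : ℝ) : PG (fun ω => f ω ^ a) := by
  have hp := hf.pos
  obtain ⟨hm, c, K, hc, hK, h⟩ := hf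
  refine ⟨hm.pow_const a, |a| * c, |a| * K, by positivity, by positivity, fun ω => ?_⟩
  have h1 := (Real.le_log_iff_exp_le (hp ω)).2 (h ω).1
  have h2 := (Real.log_le_iff_le_exp (hp ω)).2 (h ω).2
  have h3 : |Real.log (f ω) * a| ≤ |a| * c + |a| * K * ‖ω‖ := by
    rw [abs_mul, mul_comm]
    have := mul_le_mul_of_nonneg_left (abs_le.2 ⟨h1, h2⟩) (abs_nonneg a)
    linarith
  simp only [Real.rpow_def_of_pos (hp ω)]
  rw [abs_le] at h3
  exact ⟨Real.exp_le_exp.2 h3.1, Real.exp_le_exp.2 h3.2⟩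

lemma PG.inv {f : Om r m n → ℝ} (hf : PG f) : PG (fun ω => (f ω)⁻¹) := by
  have := hf.rpow (-1)
  simpa only [Real.rpow_neg_one] using this

lemma PG.mul {f g : Om r m n → ℝ} (hf : PG f) (hg : PG g) : PG (fun ω => f ω * g ω) := by
  have hp := hf.pos
  have hp' := hg.pos
  obtain ⟨hm, c, K, hc, hK, h⟩ := hf
  obtain ⟨hm', c', K', hc', hK', h'⟩ := hg
  refine ⟨hm.mul hm', c + c', K + K', by positivity, by positivity, fun ω => ⟨?_, ?_⟩⟩
  · have : -(c + c' + (K + K') * ‖ω‖) = -(c + K * ‖ω‖) + -(c' + K' * ‖ω‖) := by ring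
    rw [this, Real.exp_add]
    exact mul_le_mul (h ω).1 (h' ω).1 (Real.exp_pos _).le (hp ω).le
  · have : (c + c' + (K + K') * ‖ω‖) = (c + K * ‖ω‖) + (c' + K' * ‖ω‖) := by ring
    rw [this, Real.exp_add]
    exact mul_le_mul (h ω).2 (h' ω).2 (hp' ω).le (Real.exp_pos _).le

lemma PG.one : PG (fun _ : Om r m n => (1 : ℝ)) :=
  ⟨measurable_const, 0, 0, le_rfl, le_rfl, fun ω => by simp⟩

lemma PG.prod {ι : Type*} (S : Finset ι) {f : ι → Om r m n → ℝ} (hf : ∀ i ∈ S, PG (f i)) :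
    PG (fun ω => ∏ i ∈ S, f i ω) := by
  classical
  induction S using Finset.induction_on with
  | empty => simpa using PG.one
  | insert a S ha ih =>
    simp only [Finset.prod_insert ha]
    exact (hf a (Finset.mem_insert_self _ _)).mul
      (ih fun i hi => hf i (Finset.mem_insert_of_mem hi))

lemma PG.add {f g : Om r m n → ℝ} (hf : PG f) (hg : PG g) : PG (fun ω => f ω + g ω) := by
  have hp := hf.pos
  have hp' := hg.pos
  obtain ⟨hm, c, K, hc, hK, h⟩ := hf
  obtain ⟨hm', c', K', hc', hK', h'⟩ := hg
  refine ⟨hm.add hm', Real.log 2 + c + c', K + K', by positivity, by positivity,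
    fun ω => ⟨?_, ?_⟩⟩
  · have h2 : 0 ≤ Real.log 2 := by positivity
    have : -(Real.log 2 + c + c' + (K + K') * ‖ω‖) ≤ -(c + K * ‖ω‖) := by
      have : 0 ≤ K' * ‖ω‖ := by positivity
      nlinarith
    have := (Real.exp_le_exp.2 this).trans (h ω).1
    have := hp' ω
    linarith
  · have e : (Real.log 2 + c + c' + (K + K') * ‖ω‖)
      = Real.log 2 + (c + K * ‖ω‖ + (c' + K' * ‖ω‖)) := by ring
    rw [e, Real.exp_add, Real.exp_log (by norm_num)]
    have n1 : 0 ≤ K * ‖ω‖ := by positivity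
    have n2 : 0 ≤ K' * ‖ω‖ := by positivity
    have h1 := (h ω).2.trans (Real.exp_le_exp.2
      (show c + K * ‖ω‖ ≤ c + K * ‖ω‖ + (c' + K' * ‖ω‖) by linarith))
    have h2 := (h' ω).2.trans (Real.exp_le_exp.2
      (show c' + K' * ‖ω‖ ≤ c + K * ‖ω‖ + (c' + K' * ‖ω‖) by linarith))
    linarith

lemma PG.sum {ι : Type*} {S : Finset ι} (hS : S.Nonempty) {f : ι → Om r m n → ℝ}
    (hf : ∀ i ∈ S, PG (f i)) :
    PG (fun ω => ∑ i ∈ S, f i ω) := by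
  classical
  induction hS using Finset.Nonempty.cons_induction with
  | singleton a => simpa using hf a (by simp)
  | cons a S ha hS ih =>
    simp only [Finset.sum_cons]
    exact (hf a (by simp)).add (ih fun i hi => hf i (by simp [hi]))

lemma EG.mul {f g : Om r m n → ℝ} (hf : EG f) (hg : EG g) : EG (fun ω => f ω * g ω) := by
  obtain ⟨hm, c, K, hc, hK, h⟩ := hf
  obtain ⟨hm', c', K', hc', hK', h'⟩ := hg
  refine ⟨hm.mul hm', c * c', K + K', by positivity, by positivity, fun ω => ?_⟩
  rw [abs_mul, add_mul, Real.exp_add]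
  calc |f ω| * |g ω| ≤ (c * Real.exp (K * ‖ω‖)) * (c' * Real.exp (K' * ‖ω‖)) :=
        mul_le_mul (h ω) (h' ω) (abs_nonneg _) (by positivity)
    _ = _ := by ring

lemma EG.const (a : ℝ) : EG (fun _ : Om r m n => a) :=
  ⟨measurable_const, |a|, 0, abs_nonneg _, le_rfl, fun ω => by simp⟩

lemma EG.add {f g : Om r m n → ℝ} (hf : EG f) (hg : EG g) : EG (fun ω => f ω + g ω) := by
  obtain ⟨hm, c, K, hc, hK, h⟩ := hf
  obtain ⟨hm', c', K', hc', hK', h'⟩ := hg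
  refine ⟨hm.add hm', c + c', K + K', by positivity, by positivity, fun ω => ?_⟩
  have n1 : 0 ≤ K * ‖ω‖ := by positivity
  have n2 : 0 ≤ K' * ‖ω‖ := by positivity
  rw [add_mul]
  have h1 : Real.exp (K * ‖ω‖) ≤ Real.exp ((K + K') * ‖ω‖) := Real.exp_le_exp.2 (by linarith)
  have h2 : Real.exp (K' * ‖ω‖) ≤ Real.exp ((K + K') * ‖ω‖) := Real.exp_le_exp.2 (by linarith)
  exact (abs_add_le _ _).trans (add_le_add ((h ω).trans (mul_le_mul_of_nonneg_left h1 hc))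
    ((h' ω).trans (mul_le_mul_of_nonneg_left h2 hc')))

lemma EG.sum {ι : Type*} (S : Finset ι) {f : ι → Om r m n → ℝ} (hf : ∀ i ∈ S, EG (f i)) :
    EG (fun ω => ∑ i ∈ S, f i ω) := by
  classical
  induction S using Finset.induction_on with
  | empty => simpa using EG.const 0
  | insert a S ha ih =>
    simp only [Finset.sum_insert ha]
    exact (hf a (Finset.mem_insert_self _ _)).add
      (ih fun i hi => hf i (Finset.mem_insert_of_mem hi))

lemma EG.integrable {f : Om r m n → ℝ} (hf : EG f) : Integrable f (muAll r m n) := by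
  obtain ⟨hm, c, K, hc, hK, h⟩ := hf
  exact ((expInt_muAll r m n K hK).const_mul c).mono' hm.aestronglyMeasurable
    (Filter.Eventually.of_forall h)

lemma EG.bd_upd {f : Om r m n → ℝ} {c K : ℝ} (hc : 0 ≤ c) (hK : 0 ≤ K)
    (h : ∀ ω, |f ω| ≤ c * Real.exp (K * ‖ω‖)) (v : Fin (r+1)) (ω : Om r m n) (u : Us m n) :
    |f (upd ω v u)| ≤ c * Real.exp (K * ‖ω‖) * Real.exp (K * ‖u‖) := by
  rw [mul_assoc, ← Real.exp_add, ← mul_add]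
  refine (h _).trans (mul_le_mul_of_nonneg_left (Real.exp_le_exp.2 ?_) hc)
  exact mul_le_mul_of_nonneg_left (norm_upd_le _ _ _) hK

lemma EG.integrable_upd {f : Om r m n → ℝ} (hf : EG f) (v : Fin (r+1)) (ω : Om r m n) :
    Integrable (fun u => f (upd ω v u)) (muU m n) := by
  obtain ⟨hm, c, K, hc, hK, h⟩ := hf
  refine ((expInt_muU m n K hK).const_mul (c * Real.exp (K * ‖ω‖))).mono'
    (hm.comp ((measurable_upd v).comp measurable_prodMk_left)).aestronglyMeasurable
    (Filter.Eventually.of_forall fun u => EG.bd_upd hc hK h v ω u)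

lemma measurable_Iv {f : Om r m n → ℝ} (hf : Measurable f) (v : Fin (r+1)) :
    Measurable (Iv v f) := by
  have h : StronglyMeasurable (fun z : Om r m n × Us m n => f (upd z.1 v z.2)) :=
    (hf.comp (measurable_upd v)).stronglyMeasurable
  exact h.integral_prod_right'.measurable

lemma EG.Iv {f : Om r m n → ℝ} (hf : EG f) (v : Fin (r+1)) : EG (Iv v f) := by
  have hi := hf.integrable_upd v
  obtain ⟨hm, c, K, hc, hK, h⟩ := hf
  refine ⟨measurable_Iv hm v, c * ∫ u, Real.exp (K * ‖u‖) ∂muU m n, K, ?_, hK, fun ω => ?_⟩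
  · exact mul_nonneg hc (integral_nonneg fun u => (Real.exp_pos _).le)
  · unfold SFLR.Iv
    have h1 := norm_integral_le_of_norm_le (f := fun u => f (upd ω v u))
      ((expInt_muU m n K hK).const_mul (c * Real.exp (K * ‖ω‖)))
      (Filter.Eventually.of_forall fun u => (EG.bd_upd hc hK h v ω u))
    rw [integral_const_mul] at h1
    refine h1.trans (le_of_eq (by ring))

lemma PG.Iv {f : Om r m n → ℝ} (hf : PG f) (v : Fin (r+1)) : PG (Iv v f) := by
  have hi := hf.eg.integrable_upd v
  obtain ⟨hm, c, K, hc, hK, h⟩ := hf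
  have i1 := expInt_muU m n K hK
  have i2 : Integrable (fun u : Us m n => Real.exp (-(K * ‖u‖))) (muU m n) := by
    refine i1.mono' (by fun_prop) (Filter.Eventually.of_forall fun u => ?_)
    simp only [Real.norm_eq_abs, Real.abs_exp]
    apply Real.exp_le_exp.2
    have : 0 ≤ K * ‖u‖ := by positivity
    linarith
  set M := ∫ u, Real.exp (K * ‖u‖) ∂muU m n with hM
  set N := ∫ u, Real.exp (-(K * ‖u‖)) ∂muU m n with hN
  have hMpos : 0 < M := integral_exp_pos i1
  have hNpos : 0 < N := integral_exp_pos i2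
  refine ⟨measurable_Iv hm v, c + |Real.log M| + |Real.log N|, K, by positivity, hK,
    fun ω => ⟨?_, ?_⟩⟩
  · have h1 : ∫ u, Real.exp (-(c + K * ‖ω‖)) * Real.exp (-(K * ‖u‖)) ∂muU m n
        ≤ SFLR.Iv v f ω := by
      refine integral_mono (i2.const_mul _) (hi ω) fun u => ?_
      refine le_trans ?_ (h _).1
      simp only
      rw [← Real.exp_add]
      apply Real.exp_le_exp.2
      have := mul_le_mul_of_nonneg_left (norm_upd_le ω v u) hK
      linarith
    rw [integral_const_mul] at h1
    refine le_trans ?_ h1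
    rw [← hN]
    nth_rw 2 [← Real.exp_log hNpos]
    rw [← Real.exp_add]
    apply Real.exp_le_exp.2
    have := neg_abs_le (Real.log N)
    have := abs_nonneg (Real.log M)
    linarith
  · have h1 : SFLR.Iv v f ω ≤ ∫ u, Real.exp (c + K * ‖ω‖) * Real.exp (K * ‖u‖) ∂muU m n := by
      refine integral_mono (hi ω) (i1.const_mul _) fun u => ?_
      refine (h _).2.trans ?_
      rw [← Real.exp_add]
      apply Real.exp_le_exp.2
      have := mul_le_mul_of_nonneg_left (norm_upd_le ω v u) hK
      linarith
    rw [integral_const_mul] at h1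
    refine h1.trans ?_
    rw [← hM]
    nth_rw 1 [← Real.exp_log hMpos]
    rw [← Real.exp_add]
    apply Real.exp_le_exp.2
    have := le_abs_self (Real.log M)
    have := abs_nonneg (Real.log N)
    linarith

lemma mp_prod_fst {X Y Z : Type*} [MeasurableSpace X] [MeasurableSpace Y] [MeasurableSpace Z]
    {μ : Measure X} {ν : Measure Y} {ζ : Measure Z} [IsProbabilityMeasure μ]
    [IsProbabilityMeasure ν] [IsProbabilityMeasure ζ]
    {R : X × Z → X} (hR : MeasurePreserving R (μ.prod ζ) μ) :
    MeasurePreserving (fun z : (Y × X) × Z => (z.1.1, R (z.1.2, z.2)))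
      ((ν.prod μ).prod ζ) (ν.prod μ) := by
  have h1 : MeasurePreserving (MeasurableEquiv.prodAssoc : (Y × X) × Z ≃ᵐ Y × X × Z)
    ((ν.prod μ).prod ζ) (ν.prod (μ.prod ζ)) := measurePreserving_prodAssoc ν μ ζ
  exact ((MeasurePreserving.id ν).prod hR).comp h1

lemma mp_prod_swap {X Y Z : Type*} [MeasurableSpace X] [MeasurableSpace Y] [MeasurableSpace Z]
    {μ : Measure X} {ν : Measure Y} {ζ : Measure Z} [IsProbabilityMeasure μ]
    [IsProbabilityMeasure ν] [IsProbabilityMeasure ζ]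
    {R : X × Z → X} (hR : MeasurePreserving R (μ.prod ζ) μ) :
    MeasurePreserving (fun z : (X × Y) × Z => (R (z.1.1, z.2), z.1.2))
      ((μ.prod ν).prod ζ) (μ.prod ν) := by
  have h1 := mp_prod_fst (ν := ν) hR
  have h2 : MeasurePreserving (Prod.map Prod.swap id : (X × Y) × Z → (Y × X) × Z)
    ((μ.prod ν).prod ζ) ((ν.prod μ).prod ζ) :=
    (Measure.measurePreserving_swap).prod (MeasurePreserving.id ζ)
  exact (Measure.measurePreserving_swap).comp (h1.comp h2)

lemma mp_pi {ι : Type*} [Fintype ι] [DecidableEq ι] {X Z : Type*} [MeasurableSpace X]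
    [MeasurableSpace Z] {μ : Measure X} [IsProbabilityMeasure μ] {ζ : Measure Z}
    [IsProbabilityMeasure ζ] {R : X × Z → X} (hR : MeasurePreserving R (μ.prod ζ) μ) (k : ι) :
    MeasurePreserving (fun z : (ι → X) × Z => Function.update z.1 k (R (z.1 k, z.2)))
      ((Measure.pi fun _ : ι => μ).prod ζ) (Measure.pi fun _ : ι => μ) := by
  have hS := mp_update (ι := ι) μ k
  have hT := hS.comp (mp_prod_fst (ν := Measure.pi fun _ : ι => μ) hR)
  have hS' := hS.prod (MeasurePreserving.id ζ)
  have hm : Measurable (fun z : (ι → X) × Z => Function.update z.1 k (R (z.1 k, z.2))) :=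
    measurable_update'.comp (measurable_fst.prodMk (hR.measurable.comp
      (((measurable_pi_apply k).comp measurable_fst).prodMk measurable_snd)))
  refine ⟨hm, ?_⟩
  nth_rw 1 [← hS'.map_eq]
  rw [Measure.map_map hm hS'.measurable]
  refine Eq.trans ?_ hT.map_eq
  congr 1
  funext z
  simp [Function.comp]

/-- Replace one scalar coordinate `u_j^{(2,k)}`. -/
def repl (k : Fin (r+1)) (j : Fin m) (z : Om r m n × ℝ) : Om r m n :=
  (z.1.1, Function.update z.1.2 k
    ((z.1.2 k).1, (Function.update (z.1.2 k).2.1 j z.2, (z.1.2 k).2.2)))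

lemma mp_repl (k : Fin (r+1)) (j : Fin m) :
    MeasurePreserving (repl (n := n) k j) ((muAll r m n).prod stdG) (muAll r m n) := by
  have h1 : MeasurePreserving (fun z : (Fin m → ℝ) × ℝ => Function.update z.1 j z.2)
    ((gVec m).prod stdG) (gVec m) := mp_update stdG j
  have h2 := mp_prod_swap (ν := gVec n) h1
  have h3 := mp_prod_fst (ν := stdG) h2
  have h4 := mp_pi h3 k
  exact mp_prod_fst (ν := gMat m n) h4

lemma mp_upd (v : Fin (r+1)) :
    MeasurePreserving (fun z : Om r m n × Us m n => upd z.1 v z.2)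
      ((muAll r m n).prod (muU m n)) (muAll r m n) :=
  mp_prod_fst (ν := gMat m n) (mp_update (muU m n) v)

lemma integral_Iv {f : Om r m n → ℝ} (hf : EG f) (v : Fin (r+1)) :
    ∫ ω, Iv v f ω ∂muAll r m n = ∫ ω, f ω ∂muAll r m n := by
  have h := mp_upd (m := m) (n := n) v
  rw [← h.map_eq, integral_map h.measurable.aemeasurable hf.1.aestronglyMeasurable, h.map_eq]
  exact (integral_prod _ (h.integrable_comp_of_integrable hf.integrable)).symm

end classes

section deriv

variable {r : ℕ}

/-- `f` does not depend on the group `v`. -/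
def Ind (v : Fin (r+1)) (f : Om r m n → ℝ) : Prop := ∀ ω u, f (upd ω v u) = f ω

lemma Ind.Iv_mul {v : Fin (r+1)} {f : Om r m n → ℝ} (hf : Ind v f) (g : Om r m n → ℝ)
    (ω : Om r m n) : Iv v (fun ω => f ω * g ω) ω = f ω * Iv v g ω := by
  unfold Iv
  simp only [hf ω]
  rw [integral_const_mul]

lemma ind_Iv_self (v : Fin (r+1)) (f : Om r m n → ℝ) : Ind v (Iv v f) := by
  intro ω u
  unfold Iv upd
  simp

lemma Ind.Iv {v : Fin (r+1)} {f : Om r m n → ℝ} (hf : Ind v f) (w : Fin (r+1)) :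
    Ind v (Iv w f) := by
  by_cases h : w = v
  · subst h; exact ind_Iv_self _ _
  intro ω u
  unfold SFLR.Iv
  congr 1
  funext u'
  have : upd (upd ω v u) w u' = upd (upd ω w u') v u := by
    unfold upd
    simp only
    rw [Function.update_comm (Ne.symm h)]
  rw [this, hf]

lemma Ind.comp {v : Fin (r+1)} {f : Om r m n → ℝ} (hf : Ind v f) (φ : ℝ → ℝ) :
    Ind v (fun ω => φ (f ω)) := fun ω u => by simp only [hf ω u]

lemma Ind.comp2 {v : Fin (r+1)} {f g : Om r m n → ℝ} (hf : Ind v f) (hg : Ind v g)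
    (φ : ℝ → ℝ → ℝ) :
    Ind v (fun ω => φ (f ω) (g ω)) := fun ω u => by simp only [hf ω u, hg ω u]

/-- Directional derivative, with growth control. -/
def DD (e : Om r m n) (f f' : Om r m n → ℝ) : Prop :=
  EG f ∧ EG f' ∧ ∀ ω, HasDerivAt (fun h : ℝ => f (ω + h • e)) (f' ω) 0

lemma DD.at {e : Om r m n} {f f' : Om r m n → ℝ} (hf : DD e f f') (ω) (h : ℝ) :
    HasDerivAt (fun h : ℝ => f (ω + h • e)) (f' (ω + h • e)) h := by
  have h1 := hf.2.2 (ω + h • e)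
  have h2 := HasDerivAt.comp_sub_const h h (f := fun a : ℝ => f ((ω + h • e) + a • e))
    (f' := f' (ω + h • e)) (by simpa using h1)
  refine h2.congr_of_eventuallyEq (Filter.Eventually.of_forall fun a => ?_)
  simp only
  congr 1
  rw [add_assoc, ← add_smul]
  congr 2
  ring

lemma DD.mul {e : Om r m n} {f f' g g' : Om r m n → ℝ} (hf : DD e f f') (hg : DD e g g') :
    DD e (fun ω => f ω * g ω) (fun ω => f' ω * g ω + f ω * g' ω) := by
  refine ⟨hf.1.mul hg.1, (hf.2.1.mul hg.1).add (hf.1.mul hg.2.1), fun ω => ?_⟩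
  exact ((hf.2.2 ω).mul (hg.2.2 ω)).congr_deriv (by simp)

lemma DD.add {e : Om r m n} {f f' g g' : Om r m n → ℝ} (hf : DD e f f') (hg : DD e g g') :
    DD e (fun ω => f ω + g ω) (fun ω => f' ω + g' ω) :=
  ⟨hf.1.add hg.1, hf.2.1.add hg.2.1, fun ω => (hf.2.2 ω).add (hg.2.2 ω)⟩

lemma DD.const (e : Om r m n) (a : ℝ) : DD e (fun _ => a) (fun _ => 0) :=
  ⟨EG.const a, EG.const 0, fun ω => hasDerivAt_const _ _⟩

lemma DD.congr {e : Om r m n} {f f' g' : Om r m n → ℝ} (hf : DD e f f') (h : ∀ ω, f' ω = g' ω) :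
    DD e f g' := by
  have : f' = g' := funext h
  exact this ▸ hf

lemma DD.sum {ι : Type*} (S : Finset ι) {e : Om r m n} {f f' : ι → Om r m n → ℝ}
    (hf : ∀ i ∈ S, DD e (f i) (f' i)) :
    DD e (fun ω => ∑ i ∈ S, f i ω) (fun ω => ∑ i ∈ S, f' i ω) := by
  classical
  induction S using Finset.induction_on with
  | empty => simpa using DD.const e 0
  | insert a S ha ih =>
    simp only [Finset.sum_insert ha]
    exact (hf a (Finset.mem_insert_self _ _)).add
      (ih fun i hi => hf i (Finset.mem_insert_of_mem hi))

lemma DD.rpow {e : Om r m n} {f f' : Om r m n → ℝ} (hf : DD e f f') (hp : PG f) (a : ℝ) :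
    DD e (fun ω => f ω ^ a) (fun ω => a * f ω ^ (a - 1) * f' ω) := by
  refine ⟨(hp.rpow a).eg, ((EG.const a).mul (hp.rpow (a-1)).eg).mul hf.2.1, fun ω => ?_⟩
  have h0 : f (ω + (0:ℝ) • e) = f ω := by simp
  have := (hf.2.2 ω).rpow_const (p := a) (Or.inl (by rw [h0]; exact (hp.pos ω).ne'))
  simp only [h0] at this
  exact this.congr_deriv (by ring)

/-- Logarithmic derivative of a product of powers. -/
lemma DD.prod_rpow {ι : Type*} (S : Finset ι) {e : Om r m n} {f f' : ι → Om r m n → ℝ}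
    (a : ι → ℝ) (hf : ∀ i ∈ S, DD e (f i) (f' i)) (hp : ∀ i ∈ S, PG (f i)) :
    DD e (fun ω => ∏ i ∈ S, f i ω ^ a i)
      (fun ω => (∏ i ∈ S, f i ω ^ a i) * ∑ i ∈ S, a i * (f' i ω / f i ω)) := by
  classical
  induction S using Finset.induction_on with
  | empty => simpa using DD.const e 1
  | insert b S ha ih =>
    simp only [Finset.sum_insert ha, Finset.prod_insert ha]
    have hb := hp b (Finset.mem_insert_self _ _)
    have h1 := ((hf b (Finset.mem_insert_self _ _)).rpow hb (a b)).mul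
      (ih (fun i hi => hf i (Finset.mem_insert_of_mem hi))
        (fun i hi => hp i (Finset.mem_insert_of_mem hi)))
    refine h1.congr fun ω => ?_
    rw [Real.rpow_sub_one (hb.pos ω).ne']
    ring

lemma DD.ind {v : Fin (r+1)} {e : Om r m n} (he : e.1 = 0) (he2 : ∀ w, w ≠ v → e.2 w = 0)
    {f : Om r m n → ℝ} (hf : Ind v f) (hE : EG f) : DD e f (fun _ => 0) := by
  refine ⟨hE, EG.const 0, fun ω => ?_⟩
  have : ∀ h : ℝ, f (ω + h • e) = f ω := by
    intro h
    have h1 : ω + h • e = upd ω v (ω.2 v + h • e.2 v) := by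
      unfold upd
      apply Prod.ext
      · simp [he]
      · funext w
        by_cases hw : w = v
        · subst hw; simp
        · simp [hw, he2 w hw]
    rw [h1, hf]
  simp only [this]
  exact hasDerivAt_const _ _

lemma upd_add (ω e : Om r m n) (v : Fin (r+1)) (he : e.2 v = 0) (h : ℝ) (u : Us m n) :
    upd (ω + h • e) v u = upd ω v u + h • e := by
  unfold upd
  apply Prod.ext
  · simp
  · funext w
    by_cases hw : w = v
    · subst hw; simp [he]
    · simp [hw]

lemma DD.Iv {e : Om r m n} {f f' : Om r m n → ℝ} (hf : DD e f f') {v : Fin (r+1)}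
    (he : e.2 v = 0) : DD e (Iv v f) (Iv v f') := by
  refine ⟨hf.1.Iv v, hf.2.1.Iv v, fun ω => ?_⟩
  unfold SFLR.Iv
  simp only [upd_add ω e v he]
  obtain ⟨hm, c, K, hc, hK, hb⟩ := hf.2.1
  have hmeas : ∀ g : Om r m n → ℝ, Measurable g → ∀ h : ℝ,
      AEStronglyMeasurable (fun u => g (upd ω v u + h • e)) (muU m n) := by
    intro g hg h
    simp only [← upd_add ω e v he]
    exact (hg.comp ((measurable_upd v).comp measurable_prodMk_left)).aestronglyMeasurable
  have key := hasDerivAt_integral_of_dominated_loc_of_deriv_le (μ := muU m n)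
    (F := fun (h : ℝ) u => f (upd ω v u + h • e)) (F' := fun (h : ℝ) u => f' (upd ω v u + h • e))
    (x₀ := 0) (s := Metric.ball 0 1)
    (bound := fun u => c * Real.exp (K * (‖ω‖ + ‖e‖)) * Real.exp (K * ‖u‖))
    (Metric.ball_mem_nhds _ one_pos)
    (Filter.Eventually.of_forall fun h => hmeas f hf.1.1 h)
    (by simpa using hf.1.integrable_upd v ω)
    (hmeas f' hm 0)
    (Filter.Eventually.of_forall fun u h hh => by
      rw [Real.norm_eq_abs, mul_assoc, ← Real.exp_add, ← mul_add]
      refine (hb _).trans (mul_le_mul_of_nonneg_left (Real.exp_le_exp.2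
        (mul_le_mul_of_nonneg_left ?_ hK)) hc)
      have h1 : ‖h • e‖ ≤ ‖e‖ := by
        rw [norm_smul]
        have : ‖h‖ ≤ 1 := by simpa using (mem_ball_zero_iff.1 hh).le
        exact mul_le_of_le_one_left (norm_nonneg _) this
      have h2 := norm_upd_le ω v u
      have h3 := norm_add_le (upd ω v u) (h • e)
      linarith)
    ((expInt_muU m n K hK).const_mul _)
    (Filter.Eventually.of_forall fun u h _ => hf.at _ h)
  simpa using key.2

/-- The coordinate direction of `u_j^{(2,k)}`. -/
def dir (k : Fin (r+1)) (j : Fin m) : Om r m n :=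
  (0, Pi.single k (0, (Pi.single j 1, 0)))

/-- The coordinate `u_j^{(2,k)}`. -/
def cf (k : Fin (r+1)) (j : Fin m) (ω : Om r m n) : ℝ := (ω.2 k).2.1 j

lemma abs_cf_le (k : Fin (r+1)) (j : Fin m) (ω : Om r m n) : |cf k j ω| ≤ ‖ω‖ := by
  unfold cf
  calc |(ω.2 k).2.1 j| ≤ ‖(ω.2 k).2.1‖ := norm_le_pi_norm (ω.2 k).2.1 j
    _ ≤ ‖(ω.2 k).2‖ := norm_fst_le _
    _ ≤ ‖ω.2 k‖ := norm_snd_le _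
    _ ≤ ‖ω.2‖ := norm_le_pi_norm ω.2 k
    _ ≤ ‖ω‖ := norm_snd_le _

lemma measurable_cf (k : Fin (r+1)) (j : Fin m) : Measurable (cf (n := n) k j) := by
  unfold cf
  fun_prop

lemma EG.cf (k : Fin (r+1)) (j : Fin m) : EG (cf (n := n) k j) := by
  refine ⟨measurable_cf k j, 1, 1, zero_le_one, zero_le_one, fun ω => ?_⟩
  have h1 := abs_cf_le k j ω
  have h2 := Real.add_one_le_exp ‖ω‖
  rw [one_mul, one_mul]
  linarith

lemma repl_eq (k : Fin (r+1)) (j : Fin m) (ω : Om r m n) (a : ℝ) :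
    repl k j (ω, a) = repl k j (ω, 0) + a • dir k j := by
  unfold repl dir
  apply Prod.ext
  · simp
  · funext w
    by_cases hw : w = k
    · subst hw
      simp only [Function.update_self, Prod.snd_add, Prod.smul_snd, Pi.add_apply, Pi.smul_apply,
        Pi.single_eq_same]
      refine Prod.ext (by simp) (Prod.ext ?_ (by simp))
      funext i
      by_cases hi : i = j
      · subst hi; simp
      · simp [hi]
    · simp [hw]

/-- Gaussian integration by parts on the full space. -/
lemma ibp {k : Fin (r+1)} {j : Fin m} {f f' : Om r m n → ℝ} (hf : DD (dir k j) f f') :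
    ∫ ω, cf k j ω * f ω ∂muAll r m n = ∫ ω, f' ω ∂muAll r m n := by
  have h := mp_repl (n := n) k j
  have pull : ∀ g : Om r m n → ℝ, EG g → ∫ ω, g ω ∂muAll r m n
      = ∫ ω, ∫ a, g (repl k j (ω, a)) ∂stdG ∂muAll r m n := by
    intro g hg
    rw [← h.map_eq, integral_map h.measurable.aemeasurable hg.1.aestronglyMeasurable, h.map_eq]
    exact integral_prod _ (h.integrable_comp_of_integrable hg.integrable)
  rw [pull _ ((EG.cf k j).mul hf.1), pull _ hf.2.1]
  congr 1
  funext ω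
  have hcf : ∀ a, cf k j (repl k j (ω, a)) = a := by
    intro a; simp [cf, repl]
  simp only [hcf]
  have hgrow : ∀ g : Om r m n → ℝ, EG g → ∃ C K : ℝ, 0 ≤ C ∧ 0 ≤ K ∧ ∀ a,
      |g (repl k j (ω, a))| ≤ C * Real.exp (K * |a|) := by
    rintro g ⟨_, c, K, hc, hK, hb⟩
    refine ⟨c * Real.exp (K * ‖repl k j (ω, 0)‖), K * ‖dir (n := n) k j‖, by positivity,
      by positivity, fun a => ?_⟩
    rw [mul_assoc, ← Real.exp_add]
    refine (hb _).trans (mul_le_mul_of_nonneg_left (Real.exp_le_exp.2 ?_) hc)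
    rw [repl_eq]
    have h3 := norm_add_le (repl k j (ω, 0)) (a • dir k j)
    rw [norm_smul, Real.norm_eq_abs] at h3
    have := mul_le_mul_of_nonneg_left h3 hK
    linarith
  obtain ⟨C, K, hC, hK, hb⟩ := hgrow f hf.1
  obtain ⟨C', K', hC', hK', hb'⟩ := hgrow f' hf.2.1
  have up : ∀ a : ℝ, C * Real.exp (K * |a|) ≤ (C + C') * Real.exp ((K + K') * |a|) := fun a => by
    apply mul_le_mul (by linarith) (Real.exp_le_exp.2 _) (Real.exp_pos _).le (by linarith)
    have : 0 ≤ K' * |a| := by positivity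
    linarith
  have up' : ∀ a : ℝ, C' * Real.exp (K' * |a|) ≤ (C + C') * Real.exp ((K + K') * |a|) := fun a => by
    apply mul_le_mul (by linarith) (Real.exp_le_exp.2 _) (Real.exp_pos _).le (by linarith)
    have : 0 ≤ K * |a| := by positivity
    linarith
  refine stein_one (f := fun a => f (repl k j (ω, a))) (f' := fun a => f' (repl k j (ω, a)))
    (fun a => ?_) (hf.2.1.1.comp (h.measurable.comp measurable_prodMk_left))
    (K := K + K') (by linarith) (C := C + C') (fun a => (hb a).trans (up a))
    (fun a => (hb' a).trans (up' a))
  have := hf.at (repl k j (ω, 0)) a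
  rw [← repl_eq] at this
  exact this.congr_of_eventuallyEq (Filter.Eventually.of_forall fun b => by
    simp only
    rw [repl_eq k j ω b])

end deriv

section chain

variable {r : ℕ}

/-- A chain of successively integrated positive functions. -/
structure Chain (r : ℕ) (mv : ℕ → ℝ) (ζ : ℕ → Om r m n → ℝ) : Prop where
  pg0 : PG (ζ 0)
  step : ∀ v (h : v < r), ζ (v+1)
    = Iv ⟨v, h.trans (Nat.lt_succ_self r)⟩ (fun ω => ζ v ω ^ (mv (v+1) / mv v))
  mv0 : mv 0 = 1
  mvne : ∀ v, v ≤ r → mv v ≠ 0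
  mvlast : mv (r+1) = 0

/-- Nested expectations over a chain. -/
def nst (mv : ℕ → ℝ) (ζ : ℕ → Om r m n → ℝ) (g : Om r m n → ℝ) : ℕ → Om r m n → ℝ
  | 0 => g
  | v+1 => if h : v < r + 1 then
      Iv ⟨v, h⟩ (fun ω => ζ v ω ^ (mv (v+1) / mv v - 1) * nst mv ζ g v ω) else 0

/-- Tail products of the weights. -/
def Pt (mv : ℕ → ℝ) (ζ : ℕ → Om r m n → ℝ) (v : ℕ) (ω : Om r m n) : ℝ :=
  ∏ w ∈ Finset.Ico v (r+1), ζ w ω ^ (mv (w+1) / mv w - 1)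

variable {mv : ℕ → ℝ} {ζ : ℕ → Om r m n → ℝ}

lemma Chain.pg (H : Chain r mv ζ) : ∀ v, v ≤ r → PG (ζ v)
  | 0, _ => H.pg0
  | v+1, h => by
      rw [H.step v h]
      exact ((H.pg v (by omega)).rpow _).Iv _

lemma Chain.ind (H : Chain r mv ζ) : ∀ v, v ≤ r → ∀ w (h : w < v) (h' : w < r + 1),
    Ind ⟨w, h'⟩ (ζ v)
  | 0, _, w, h, _ => absurd h (by omega)
  | v+1, hv, w, h, h' => by
      rw [H.step v hv]
      by_cases hw : w = v
      · subst hw; exact ind_Iv_self _ _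
      · exact ((H.ind v (by omega) w (by omega) h').comp (fun z => z ^ (mv (v+1) / mv v))).Iv _

lemma nst_succ (g : Om r m n → ℝ) {v : ℕ} (h : v < r + 1) : nst mv ζ g (v+1)
    = Iv ⟨v, h⟩ (fun ω => ζ v ω ^ (mv (v+1) / mv v - 1) * nst mv ζ g v ω) := by
  rw [nst, dif_pos h]

lemma Chain.nst_eg (H : Chain r mv ζ) {g : Om r m n → ℝ} (hg : EG g) :
    ∀ v, v ≤ r → EG (nst mv ζ g v)
  | 0, _ => hg
  | v+1, h => by
      rw [nst_succ g (by omega)]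
      exact (((H.pg v (by omega)).rpow _).eg.mul (H.nst_eg hg v (by omega))).Iv _

lemma Chain.nst_ind (H : Chain r mv ζ) (g : Om r m n → ℝ) :
    ∀ v, v ≤ r → ∀ w (h : w < v) (h' : w < r + 1), Ind ⟨w, h'⟩ (nst mv ζ g v)
  | 0, _, w, h, _ => absurd h (by omega)
  | v+1, hv, w, h, h' => by
      rw [nst_succ g (by omega)]
      by_cases hw : w = v
      · subst hw; exact ind_Iv_self _ _
      · exact ((H.ind v (by omega) w (by omega) h').comp2 (H.nst_ind g v (by omega) w (by omega) h')
          (fun a b => a ^ (mv (v+1) / mv v - 1) * b)).Iv _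

lemma Chain.nst_sum (H : Chain r mv ζ) {ι : Type*} (S : Finset ι) (c : ι → ℝ)
    {g : ι → Om r m n → ℝ} (hg : ∀ i, EG (g i)) :
    ∀ v, v ≤ r → ∀ ω, nst mv ζ (fun ω => ∑ i ∈ S, c i * g i ω) v ω
      = ∑ i ∈ S, c i * nst mv ζ (g i) v ω
  | 0, _, ω => rfl
  | v+1, h, ω => by
      simp only [nst_succ _ (show v < r + 1 by omega)]
      simp only [H.nst_sum S c hg v (by omega)]
      unfold Iv
      simp only [Finset.mul_sum]
      rw [integral_finsetSum]
      · apply Finset.sum_congr rfl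
        intro i _
        rw [← integral_const_mul]
        congr 1
        funext u
        ring
      · intro i _
        exact EG.integrable_upd (((H.pg v (by omega)).rpow _).eg.mul
          ((EG.const (c i)).mul (H.nst_eg (hg i) v (by omega)))) _ ω

lemma Chain.Pt_pg (H : Chain r mv ζ) (v : ℕ) : PG (Pt mv ζ v) := by
  unfold Pt
  refine PG.prod _ fun w hw => (H.pg w ?_).rpow _
  have := (Finset.mem_Ico.1 hw).2
  omega

lemma Chain.Pt_ind (H : Chain r mv ζ) {v w : ℕ} (h : w < v) (h' : w < r + 1) :
    Ind ⟨w, h'⟩ (Pt mv ζ v) := by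
  intro ω u
  unfold Pt
  apply Finset.prod_congr rfl
  intro i hi
  have := Finset.mem_Ico.1 hi
  rw [H.ind i (by omega) w (by omega) h' ω u]

lemma Pt_succ {v : ℕ} (hv : v ≤ r) (ω : Om r m n) :
    Pt mv ζ v ω = Pt mv ζ (v+1) ω * ζ v ω ^ (mv (v+1) / mv v - 1) := by
  unfold Pt
  rw [Finset.prod_eq_prod_Ico_succ_bot (by omega), mul_comm]

lemma Chain.Pt_last (H : Chain r mv ζ) (ω : Om r m n) : Pt mv ζ r ω = (ζ r ω)⁻¹ := by
  unfold Pt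
  simp only [Nat.Ico_succ_singleton, Finset.prod_singleton, H.mvlast, zero_div, zero_sub,
    Real.rpow_neg_one]

lemma Chain.int_step (H : Chain r mv ζ) {v : ℕ} (hv : v < r) {F h : Om r m n → ℝ} (hF : EG F)
    (hh : EG h) (hi : Ind ⟨v, hv.trans (Nat.lt_succ_self r)⟩ h) :
    ∫ ω, Pt mv ζ v ω * F ω * h ω ∂muAll r m n
      = ∫ ω, Pt mv ζ (v+1) ω * Iv ⟨v, hv.trans (Nat.lt_succ_self r)⟩
          (fun ω => ζ v ω ^ (mv (v+1) / mv v - 1) * F ω) ω * h ω ∂muAll r m n := by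
  rw [← integral_Iv (((H.Pt_pg v).eg.mul hF).mul hh) ⟨v, hv.trans (Nat.lt_succ_self r)⟩]
  congr 1
  funext ω
  have e : (fun ω => Pt mv ζ v ω * F ω * h ω) = fun ω => (Pt mv ζ (v+1) ω * h ω) *
      (ζ v ω ^ (mv (v+1) / mv v - 1) * F ω) := by
    funext ω
    rw [Pt_succ hv.le]; ring
  rw [e, Ind.Iv_mul ((H.Pt_ind (Nat.lt_succ_self v) _).comp2 hi (fun a b => a * b))]
  ring

lemma Chain.int_nst (H : Chain r mv ζ) {g h : Om r m n → ℝ} (hg : EG g) (hh : EG h) :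
    ∀ v, v ≤ r → (∀ w (_ : w < v) (h' : w < r + 1), Ind ⟨w, h'⟩ h) →
    ∫ ω, Pt mv ζ 0 ω * g ω * h ω ∂muAll r m n
      = ∫ ω, Pt mv ζ v ω * nst mv ζ g v ω * h ω ∂muAll r m n
  | 0, _, _ => rfl
  | v+1, hv, hi => by
      rw [H.int_nst hg hh v (by omega) (fun w hw h' => hi w (by omega) h'),
        H.int_step hv (H.nst_eg hg v (by omega)) hh (hi v (by omega) _),
        nst_succ g (show v < r + 1 by omega)]

lemma Chain.int_nst_last (H : Chain r mv ζ) {g : Om r m n → ℝ} (hg : EG g) :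
    ∫ ω, (ζ r ω)⁻¹ * nst mv ζ g r ω ∂muAll r m n = ∫ ω, Pt mv ζ 0 ω * g ω ∂muAll r m n := by
  have := H.int_nst hg (EG.const 1) r le_rfl (fun w _ h' ω u => rfl)
  simp only [mul_one] at this
  rw [this]
  simp only [H.Pt_last]

lemma Chain.deriv_zeta (H : Chain r mv ζ) {k : Fin (r+1)} {j : Fin m} {g : Om r m n → ℝ}
    (hg : DD (dir k j) (ζ 0) g) :
    ∀ v, v ≤ r → v ≤ (k : ℕ) → DD (dir k j) (ζ v) (fun ω => mv v * nst mv ζ g v ω)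
  | 0, _, _ => by simpa [H.mv0, nst] using hg
  | v+1, hv, hk => by
      have ih := H.deriv_zeta hg v (by omega) (by omega)
      have h1 := (ih.rpow (H.pg v (by omega)) (mv (v+1) / mv v)).Iv
        (v := ⟨v, by omega⟩) (by
          unfold dir
          simp only
          rw [Pi.single_eq_of_ne]
          intro h
          rw [← h] at hk
          simp at hk)
      rw [← H.step v hv] at h1
      refine h1.congr fun ω => ?_
      rw [nst_succ g (by omega)]
      unfold Iv
      rw [← integral_const_mul]
      congr 1
      funext u
      have := H.mvne v (by omega)
      field_simp

lemma Chain.deriv_Pt (H : Chain r mv ζ) {k : Fin (r+1)} {j : Fin m} {g : Om r m n → ℝ}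
    (hg : DD (dir k j) (ζ 0) g) :
    DD (dir k j) (Pt mv ζ 0) (fun ω => Pt mv ζ 0 ω * ∑ v ∈ Finset.range (k+1),
      (mv (v+1) - mv v) * (nst mv ζ g v ω / ζ v ω)) := by
  have hd : ∀ v ∈ Finset.Ico 0 (r+1), DD (dir k j) (ζ v)
      (fun ω => if v ≤ (k : ℕ) then mv v * nst mv ζ g v ω else 0) := by
    intro v hv
    have hv := Finset.mem_Ico.1 hv
    by_cases h : v ≤ (k : ℕ)
    · simp only [h, if_true]; exact H.deriv_zeta hg v (by omega) h
    · simp only [h, if_false]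
      refine DD.ind (v := k) rfl ?_ (H.ind v (by omega) k (by omega) k.2) (H.pg v (by omega)).eg
      intro w hw
      simp [dir, hw]
  have h := DD.prod_rpow (Finset.Ico 0 (r+1)) (fun v => mv (v+1) / mv v - 1) hd
    (fun v hv => H.pg v (by have := Finset.mem_Ico.1 hv; omega))
  refine DD.congr h fun ω => ?_
  unfold Pt
  congr 1
  rw [Finset.range_eq_Ico]
  have hk := k.2
  rw [← Finset.sum_subset (s₁ := Finset.Ico 0 ((k:ℕ)+1)) (s₂ := Finset.Ico 0 (r+1))]
  · apply Finset.sum_congr rfl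
    intro v hv
    have hv := Finset.mem_Ico.1 hv
    rw [if_pos (by omega)]
    have := H.mvne v (by omega)
    field_simp
  · intro v hv
    have hv := Finset.mem_Ico.1 hv
    exact Finset.mem_Ico.2 (by omega)
  · intro v _ hv'
    have : ¬ v ≤ (k:ℕ) := fun h => hv' (Finset.mem_Ico.2 (by omega))
    rw [if_neg this]
    simp

lemma Chain.ibp (H : Chain r mv ζ) {k : Fin (r+1)} {j : Fin m} {g Q Q' : Om r m n → ℝ}
    (hg : DD (dir k j) (ζ 0) g) (hQ : DD (dir k j) Q Q') :
    ∫ ω, Pt mv ζ 0 ω * (Q ω * cf k j ω) ∂muAll r m n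
      = ∫ ω, Pt mv ζ 0 ω * Q' ω ∂muAll r m n
        + ∑ v ∈ Finset.range (k+1), (mv (v+1) - mv v) *
          ∫ ω, Pt mv ζ 0 ω * Q ω * (nst mv ζ g v ω / ζ v ω) ∂muAll r m n := by
  have hk := k.2
  have h := SFLR.ibp ((H.deriv_Pt hg).mul hQ)
  have e1 : ∀ ω : Om r m n, Pt mv ζ 0 ω * (Q ω * cf k j ω) = cf k j ω * (Pt mv ζ 0 ω * Q ω) :=
    fun ω => by ring
  simp only [e1]
  rw [h]
  have e2 : ∀ ω, (Pt mv ζ 0 ω * ∑ v ∈ Finset.range ((k:ℕ)+1),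
      (mv (v+1) - mv v) * (nst mv ζ g v ω / ζ v ω)) * Q ω + Pt mv ζ 0 ω * Q' ω
      = Pt mv ζ 0 ω * Q' ω + ∑ v ∈ Finset.range ((k:ℕ)+1),
      (mv (v+1) - mv v) * (Pt mv ζ 0 ω * Q ω * (nst mv ζ g v ω / ζ v ω)) := by
    intro ω
    rw [add_comm, Finset.mul_sum, Finset.sum_mul]
    congr 1
    apply Finset.sum_congr rfl
    intro v _
    ring
  simp only [e2]
  have hE : ∀ v ∈ Finset.range ((k:ℕ)+1),
      EG (fun ω => Pt mv ζ 0 ω * Q ω * (nst mv ζ g v ω / ζ v ω)) := by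
    intro v hv
    have hv := Finset.mem_range.1 hv
    simp only [div_eq_mul_inv]
    exact ((H.Pt_pg 0).eg.mul hQ.1).mul
      ((H.nst_eg hg.2.1 v (by omega)).mul (H.pg v (by omega)).inv.eg)
  rw [integral_add ((H.Pt_pg 0).eg.mul hQ.2.1).integrable
    (EG.sum _ fun v hv => (EG.const _).mul (hE v hv)).integrable]
  congr 1
  rw [integral_finsetSum _ fun v hv => ((EG.const _).mul (hE v hv)).integrable]
  simp only [integral_const_mul]

lemma Chain.nst_div (H : Chain r mv ζ) {F : ℕ → Om r m n → ℝ} {Q : Om r m n → ℝ}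
    (h0 : ∀ ω, F 0 ω = Q ω / ζ 0 ω)
    (hF : ∀ w (hw : w < r), ∀ ω, F (w+1) ω =
      Iv ⟨w, hw.trans (Nat.lt_succ_self r)⟩ (fun ω => ζ w ω ^ (mv (w+1) / mv w) * F w ω) ω
        / ζ (w+1) ω) :
    ∀ v, v ≤ r → ∀ ω, F v ω = nst mv ζ Q v ω / ζ v ω
  | 0, _, ω => h0 ω
  | v+1, hv, ω => by
      rw [hF v hv, nst_succ Q (show v < r + 1 by omega)]
      congr 2
      funext ω
      rw [H.nst_div h0 hF v (by omega), Real.rpow_sub_one ((H.pg v (by omega)).pos ω).ne']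
      ring

lemma Chain.phi_int (H : Chain r mv ζ) {v : ℕ} {F : ℕ → Om r m n → ℝ} (h0 : EG (F v))
    (hF : ∀ w (hw : w < r), v ≤ w → ∀ ω, F (w+1) ω =
      Iv ⟨w, hw.trans (Nat.lt_succ_self r)⟩ (fun ω => ζ w ω ^ (mv (w+1) / mv w) * F w ω) ω
        / ζ (w+1) ω) (w : ℕ) (hvw : v ≤ w) :
    w ≤ r → EG (F w) ∧ ∫ ω, Pt mv ζ v ω * (ζ v ω * F v ω) ∂muAll r m n
      = ∫ ω, Pt mv ζ w ω * (ζ w ω * F w ω) ∂muAll r m n := by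
  induction w, hvw using Nat.le_induction with
  | base => exact fun _ => ⟨h0, rfl⟩
  | succ w hw ih =>
    intro hwr
    obtain ⟨h1, h2⟩ := ih (by omega)
    have e1 := hF w (by omega) hw
    have hE : EG (F (w+1)) := by
      have := ((((H.pg w (by omega)).rpow (mv (w+1) / mv w)).eg.mul h1).Iv ⟨w, by omega⟩).mul
        (H.pg (w+1) hwr).inv.eg
      have e : F (w+1) = _ := funext e1
      rw [e]
      simpa only [div_eq_mul_inv] using this
    refine ⟨hE, h2.trans ?_⟩
    have h3 := H.int_step (v := w) (by omega) ((H.pg w (by omega)).eg.mul h1) (EG.const 1)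
      (fun ω u => rfl)
    simp only [mul_one] at h3
    rw [h3]
    congr 1
    funext ω
    rw [e1 ω, mul_div_cancel₀ _ ((H.pg (w+1) hwr).pos ω).ne']
    congr 2
    funext ω
    rw [Real.rpow_sub_one ((H.pg w (by omega)).pos ω).ne']
    have := ((H.pg w (by omega)).pos ω).ne'
    field_simp

end chain

section model

variable {r : ℕ}

/-- Unnormalised Gibbs weight. -/
def QQ (A : Fin l → Fin l → Om r m n → ℝ) (s : ℝ) (i : Fin l × Fin l) (ω : Om r m n) : ℝ :=
  (∑ i2, A i.1 i2 ω) ^ (s - 1) * A i.1 i.2 ω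

/-- The directional derivative of `QQ`, up to a scalar. -/
def EE (A : Fin l → Fin l → Om r m n → ℝ) (s : ℝ) (κ : Fin l → Fin l → ℝ) (i : Fin l × Fin l)
    (ω : Om r m n) : ℝ :=
  (s - 1) * (∑ i2, A i.1 i2 ω) ^ (s - 1 - 1) * (∑ i2, κ i.1 i2 * A i.1 i2 ω) * A i.1 i.2 ω
    + (∑ i2, A i.1 i2 ω) ^ (s - 1) * (κ i.1 i.2 * A i.1 i.2 ω)

variable {mv : ℕ → ℝ} {ζ : ℕ → Om r m n → ℝ} {A : Fin l → Fin l → Om r m n → ℝ}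

lemma PG_C (hl : 1 ≤ l) (hA : ∀ i1 i2, PG (A i1 i2)) (i1 : Fin l) :
    PG (fun ω => ∑ i2, A i1 i2 ω) := by
  have : Nonempty (Fin l) := ⟨⟨0, hl⟩⟩
  exact PG.sum Finset.univ_nonempty (fun i _ => hA i1 i)

lemma PG_QQ (hl : 1 ≤ l) (hA : ∀ i1 i2, PG (A i1 i2)) (s : ℝ) (i : Fin l × Fin l) :
    PG (QQ A s i) :=
  ((PG_C hl hA i.1).rpow (s - 1)).mul (hA i.1 i.2)

lemma PG_Z (hl : 1 ≤ l) (hA : ∀ i1 i2, PG (A i1 i2)) (s : ℝ) :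
    PG (fun ω => ∑ i1, (∑ i2, A i1 i2 ω) ^ s) := by
  have : Nonempty (Fin l) := ⟨⟨0, hl⟩⟩
  exact PG.sum Finset.univ_nonempty (fun i _ => (PG_C hl hA i).rpow s)

lemma DD_C {e : Om r m n} {b : ℝ} {κ : Fin l → Fin l → ℝ}
    (hD : ∀ i1 i2, DD e (A i1 i2) (fun ω => b * κ i1 i2 * A i1 i2 ω)) (i1 : Fin l) :
    DD e (fun ω => ∑ i2, A i1 i2 ω) (fun ω => b * ∑ i2, κ i1 i2 * A i1 i2 ω) := by
  refine (DD.sum Finset.univ (fun i _ => hD i1 i)).congr fun ω => ?_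
  rw [Finset.mul_sum]
  exact Finset.sum_congr rfl fun i _ => by ring

lemma DD_QQ (hl : 1 ≤ l) (hA : ∀ i1 i2, PG (A i1 i2)) (s : ℝ) {e : Om r m n} {b : ℝ}
    {κ : Fin l → Fin l → ℝ}
    (hD : ∀ i1 i2, DD e (A i1 i2) (fun ω => b * κ i1 i2 * A i1 i2 ω)) (i : Fin l × Fin l) :
    DD e (QQ A s i) (fun ω => b * EE A s κ i ω) := by
  refine (((DD_C hD i.1).rpow (PG_C hl hA i.1) (s - 1)).mul (hD i.1 i.2)).congr fun ω => ?_
  unfold EE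
  ring

lemma DD_Z (hl : 1 ≤ l) (hA : ∀ i1 i2, PG (A i1 i2)) (s : ℝ) {e : Om r m n} {b : ℝ}
    {κ : Fin l → Fin l → ℝ}
    (hD : ∀ i1 i2, DD e (A i1 i2) (fun ω => b * κ i1 i2 * A i1 i2 ω)) :
    DD e (fun ω => ∑ i1, (∑ i2, A i1 i2 ω) ^ s)
      (fun ω => ∑ i : Fin l × Fin l, (b * s * κ i.1 i.2) * QQ A s i ω) := by
  refine (DD.sum Finset.univ
    (fun i _ => (DD_C hD i).rpow (PG_C hl hA i) s)).congr fun ω => ?_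
  rw [Fintype.sum_prod_type]
  refine Finset.sum_congr rfl fun i _ => ?_
  rw [Finset.mul_sum, Finset.mul_sum]
  exact Finset.sum_congr rfl fun i _ => by simp only [QQ]; ring

lemma Chain.T_formula (H : Chain r mv ζ) (hl : 1 ≤ l) (hA : ∀ i1 i2, PG (A i1 i2)) (s : ℝ)
    (hζ : ζ 0 = fun ω => ∑ i1, (∑ i2, A i1 i2 ω) ^ s) {k : Fin (r+1)} {j : Fin m} {b : ℝ}
    {κ : Fin l → Fin l → ℝ}
    (hD : ∀ i1 i2, DD (dir k j) (A i1 i2) (fun ω => b * κ i1 i2 * A i1 i2 ω))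
    (i : Fin l × Fin l) :
    ∫ ω, Pt mv ζ 0 ω * (QQ A s i ω * cf k j ω) ∂muAll r m n
      = b * (∫ ω, Pt mv ζ 0 ω * EE A s κ i ω ∂muAll r m n
        + s * ∑ v ∈ Finset.range (k+1), (mv (v+1) - mv v) * ∑ p : Fin l × Fin l, κ p.1 p.2 *
          ∫ ω, Pt mv ζ 0 ω * QQ A s i ω * (nst mv ζ (QQ A s p) v ω / ζ v ω) ∂muAll r m n) := by
  have hg := DD_Z hl hA s hD
  rw [← hζ] at hg
  rw [H.ibp hg (DD_QQ hl hA s hD i), mul_add]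
  congr 1
  · rw [← integral_const_mul]
    congr 1
    funext ω
    ring
  · rw [← mul_assoc, Finset.mul_sum]
    refine Finset.sum_congr rfl fun v hv => ?_
    have hv : v ≤ r := by have := Finset.mem_range.1 hv; omega
    have e : ∀ ω, Pt mv ζ 0 ω * QQ A s i ω * (nst mv ζ
        (fun ω => ∑ i : Fin l × Fin l, (b * s * κ i.1 i.2) * QQ A s i ω) v ω / ζ v ω)
        = ∑ p : Fin l × Fin l, (b * s * κ p.1 p.2) *
          (Pt mv ζ 0 ω * QQ A s i ω * (nst mv ζ (QQ A s p) v ω / ζ v ω)) := by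
      intro ω
      rw [H.nst_sum Finset.univ _ (fun p => (PG_QQ hl hA s p).eg) v hv, Finset.sum_div,
        Finset.mul_sum]
      exact Finset.sum_congr rfl fun i _ => by ring
    simp only [e]
    rw [integral_finsetSum]
    · simp only [integral_const_mul, Finset.mul_sum]
      exact Finset.sum_congr rfl fun i _ => by ring
    · intro p _
      refine EG.integrable ((EG.const _).mul (((H.Pt_pg 0).eg.mul (PG_QQ hl hA s i).eg).mul ?_))
      simp only [div_eq_mul_inv]
      exact (H.nst_eg (PG_QQ hl hA s p).eg v hv).mul (H.pg v hv).inv.eg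

end model
section concrete

variable {r : ℕ}

/-- The exponent as a function of the sample point. -/
def dw (β s t : ℝ) (mv p q : ℕ → ℝ) (x : Fin l → Fin n → ℝ) (y : Fin l → Fin m → ℝ)
    (i1 i2 : Fin l) (ω : Om r m n) : ℝ := D0R r 1 β s t mv p q x y ω.1 ω.2 i1 i2

/-- The weights `A` as functions of the sample point. -/
def aw (β s t : ℝ) (mv p q : ℕ → ℝ) (x : Fin l → Fin n → ℝ) (y : Fin l → Fin m → ℝ)
    (i1 i2 : Fin l) (ω : Om r m n) : ℝ := AR r 1 β s t mv p q x y ω.1 ω.2 i1 i2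

/-- The functions `ζ` of the sample point. -/
def zt (β s t : ℝ) (mv p q : ℕ → ℝ) (x : Fin l → Fin n → ℝ) (y : Fin l → Fin m → ℝ)
    (v : ℕ) (ω : Om r m n) : ℝ := zetaR r 1 β s t mv p q x y ω.1 v ω.2

variable (β s t : ℝ) (mv p q : ℕ → ℝ) (x : Fin l → Fin n → ℝ) (y : Fin l → Fin m → ℝ)

lemma dw_lin (i1 i2 : Fin l) : IsLinearMap ℝ (dw (r := r) β s t mv p q x y i1 i2) := by
  constructor
  · intro a b
    simp only [dw, D0R, Prod.fst_add, Prod.snd_add, Pi.add_apply, mul_add, add_mul,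
      Finset.sum_add_distrib]
    ring
  · intro c a
    have e3 : ∀ a b : ℝ, a * (c * b) = c * (a * b) := fun a b => by ring
    simp only [dw, D0R, Prod.smul_fst, Prod.smul_snd, Pi.smul_apply, smul_eq_mul, e3,
      ← Finset.mul_sum, mul_assoc, mul_add]

lemma dw_dir (i1 i2 : Fin l) (k : Fin (r+1)) (j : Fin m) :
    dw β s t mv p q x y i1 i2 (dir k j)
      = Real.sqrt (1 - t) * nrm2 (x i1) * (y i2 j * Real.sqrt (p k - p (k+1))) := by
  have h1 : ∀ k' : Fin (r+1), ((Pi.single k ((0, (Pi.single j 1, 0)) : Us m n)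
      : Fin (r+1) → Us m n) k').1 = 0 := by
    intro k'
    by_cases h : k' = k
    · subst h; simp
    · simp [h]
  have h2 : ∀ (k' : Fin (r+1)) kk, ((Pi.single k ((0, (Pi.single j 1, 0)) : Us m n)
      : Fin (r+1) → Us m n) k').2.2 kk = 0 := by
    intro k' kk
    by_cases h : k' = k
    · subst h; simp
    · simp [h]
  have h3 : ∀ (k' : Fin (r+1)) jj, ((Pi.single k ((0, (Pi.single j 1, 0)) : Us m n)
      : Fin (r+1) → Us m n) k').2.1 jj = if k' = k then (if jj = j then 1 else 0) else 0 := by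
    intro k' jj
    by_cases h : k' = k
    · subst h; simp [Pi.single_apply]
    · simp [h]
  simp only [dw, D0R, dir, h1, h2, h3]
  simp

lemma dw_bound (i1 i2 : Fin l) : Measurable (dw (r := r) β s t mv p q x y i1 i2) ∧
    ∃ K, 0 ≤ K ∧ ∀ ω : Om r m n, |dw β s t mv p q x y i1 i2 ω| ≤ K * ‖ω‖ := by
  let L := (IsLinearMap.mk' _ (dw_lin (r := r) β s t mv p q x y i1 i2)).toContinuousLinearMap
  have e : ∀ ω, L ω = dw β s t mv p q x y i1 i2 ω := fun ω => rfl
  refine ⟨?_, ‖L‖, norm_nonneg _, fun ω => ?_⟩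
  · exact L.continuous.measurable
  · rw [← e, ← Real.norm_eq_abs]
    exact L.le_opNorm ω

lemma aw_pg (i1 i2 : Fin l) : PG (aw (r := r) β s t mv p q x y i1 i2) := by
  obtain ⟨hm, K, hK, h⟩ := dw_bound (r := r) β s t mv p q x y i1 i2
  refine ⟨Real.measurable_exp.comp (hm.const_mul β), 0, |β| * K, le_rfl, by positivity,
    fun ω => ?_⟩
  have h1 : |β * dw β s t mv p q x y i1 i2 ω| ≤ |β| * K * ‖ω‖ := by
    rw [abs_mul, mul_assoc]
    exact mul_le_mul_of_nonneg_left (h ω) (abs_nonneg _)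
  have h2 := abs_le.1 h1
  constructor
  · exact Real.exp_le_exp.2 (by rw [zero_add]; exact h2.1)
  · exact Real.exp_le_exp.2 (by rw [zero_add]; exact h2.2)

lemma aw_dd (i1 i2 : Fin l) (k : Fin (r+1)) (j : Fin m) :
    DD (dir k j) (aw (r := r) β s t mv p q x y i1 i2)
      (fun ω => Real.sqrt (p k - p (k+1)) * (β * Real.sqrt (1 - t) * nrm2 (x i1) * y i2 j)
        * aw β s t mv p q x y i1 i2 ω) := by
  have hp := aw_pg (r := r) β s t mv p q x y i1 i2
  refine ⟨hp.eg, (EG.const _).mul hp.eg, fun ω => ?_⟩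
  have hlin := dw_lin (r := r) β s t mv p q x y i1 i2
  have e : ∀ h : ℝ, aw β s t mv p q x y i1 i2 (ω + h • dir k j)
      = Real.exp (β * (dw β s t mv p q x y i1 i2 ω
        + h * dw β s t mv p q x y i1 i2 (dir k j))) := by
    intro h
    rw [← smul_eq_mul (a := h), ← hlin.map_smul, ← hlin.map_add]
    rfl
  simp only [e]
  have h1 : HasDerivAt (fun h : ℝ => β * (dw β s t mv p q x y i1 i2 ω
        + h * dw β s t mv p q x y i1 i2 (dir k j))) (β * (1 * dw β s t mv p q x y i1 i2 (dir k j)))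
        0 :=
    (((hasDerivAt_id (0:ℝ)).mul_const _).const_add _).const_mul _
  refine h1.exp.congr_deriv ?_
  rw [dw_dir]
  simp only [zero_mul, add_zero]
  have : aw β s t mv p q x y i1 i2 ω = Real.exp (β * dw β s t mv p q x y i1 i2 ω) := rfl
  rw [this]
  ring

lemma zt_chain (hl : 1 ≤ l) (hm0 : mv 0 = 1) (hmr1 : mv (r+1) = 0)
    (hmpos : ∀ k, 1 ≤ k → k ≤ r → 0 < mv k) : Chain r mv (zt (r := r) β s t mv p q x y) where
  pg0 := PG_Z hl (aw_pg (r := r) β s t mv p q x y) s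
  step := by
    intro v h
    funext ω
    simp only [zt, zetaR, dif_pos (h.trans (Nat.lt_succ_self r))]
    rfl
  mv0 := hm0
  mvne := by
    intro v hv
    rcases Nat.eq_zero_or_pos v with h | h
    · subst h; rw [hm0]; exact one_ne_zero
    · exact (hmpos v h hv).ne'
  mvlast := hmr1

lemma zt_zero : zt (r := r) β s t mv p q x y 0
    = fun ω => ∑ i1, (∑ i2, aw β s t mv p q x y i1 i2 ω) ^ s := rfl

lemma nestR_eq (g : (Fin m → Fin n → ℝ) → (Fin (r+1) → Us m n) → ℝ) : ∀ v (ω : Om r m n),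
    nestR r 1 β s t mv p q x y g v ω.1 ω.2
      = nst mv (zt β s t mv p q x y) (fun ω => g ω.1 ω.2) v ω
  | 0, ω => rfl
  | v+1, ω => by
      simp only [nestR, nst]
      split_ifs with h
      · unfold Iv
        congr 1
        funext u
        beta_reduce
        rw [← nestR_eq g v]
        rfl
      · rfl

lemma phi_lt (lo : ℕ) (f : (Fin m → Fin n → ℝ) → (Fin (r+1) → Us m n) → ℝ) :
    ∀ hi, hi < lo → PhiUpToR r 1 β s t mv p q x y lo hi f = f
  | 0, _ => rfl
  | hi+1, h => by rw [PhiUpToR, if_pos h]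

lemma phi_succ (lo : ℕ) (f : (Fin m → Fin n → ℝ) → (Fin (r+1) → Us m n) → ℝ) (w : ℕ)
    (hw : w < r) (hlo : lo ≤ w + 1) (ω : Om r m n) :
    PhiUpToR r 1 β s t mv p q x y lo (w+1) f ω.1 ω.2
      = Iv ⟨w, hw.trans (Nat.lt_succ_self r)⟩
        (fun ω => zt β s t mv p q x y w ω ^ (mv (w+1) / mv w) *
          PhiUpToR r 1 β s t mv p q x y lo w f ω.1 ω.2) ω / zt β s t mv p q x y (w+1) ω := by
  have h : w + 1 - 1 < r + 1 := by simp; omega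
  rw [PhiUpToR, if_neg (by omega)]
  simp only [PhiR]
  rw [dif_pos h]
  rfl

lemma gam_eq (hl : 1 ≤ l) (hm0 : mv 0 = 1) (hmr1 : mv (r+1) = 0)
    (hmpos : ∀ k, 1 ≤ k → k ≤ r → 0 < mv k) (i : Fin l × Fin l) (v : ℕ) (hv : v ≤ r)
    (ω : Om r m n) :
    PhiUpToR r 1 β s t mv p q x y 1 v (gam0R r 1 β s t mv p q x y i.1 i.2) ω.1 ω.2
      = nst mv (zt β s t mv p q x y) (QQ (aw β s t mv p q x y) s i) v ω
        / zt β s t mv p q x y v ω := by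
  have H := zt_chain (r := r) β s t mv p q x y hl hm0 hmr1 hmpos
  refine H.nst_div (F := fun v ω =>
    PhiUpToR r 1 β s t mv p q x y 1 v (gam0R r 1 β s t mv p q x y i.1 i.2) ω.1 ω.2)
    (fun ω => ?_) (fun w hw ω => phi_succ β s t mv p q x y 1 _ w hw (by omega) ω) v hv ω
  have hC := (PG_C hl (aw_pg (r := r) β s t mv p q x y) i.1).pos ω
  simp only [QQ]
  rw [Real.rpow_sub_one hC.ne']
  change (∑ i2, aw β s t mv p q x y i.1 i2 ω) ^ s / zt β s t mv p q x y 0 ω *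
    (aw β s t mv p q x y i.1 i.2 ω / (∑ i2, aw β s t mv p q x y i.1 i2 ω)) = _
  ring

lemma gamR_int (hl : 1 ≤ l) (hm0 : mv 0 = 1) (hmr1 : mv (r+1) = 0)
    (hmpos : ∀ k, 1 ≤ k → k ≤ r → 0 < mv k) (i i' : Fin l × Fin l) (k1 : ℕ) (hk : k1 ≤ r) :
    EG (fun ω : Om r m n => gamR r 1 β s t mv p q x y k1 i.1 i.2 i'.1 i'.2 ω.1 ω.2) ∧
    ∫ ω, Pt mv (zt β s t mv p q x y) 0 ω * QQ (aw β s t mv p q x y) s i ω *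
      (nst mv (zt β s t mv p q x y) (QQ (aw β s t mv p q x y) s i') k1 ω
        / zt β s t mv p q x y k1 ω) ∂muAll r m n
      = ∫ ω, gamR r 1 β s t mv p q x y k1 i.1 i.2 i'.1 i'.2 ω.1 ω.2 ∂muAll r m n := by
  have H := zt_chain (r := r) β s t mv p q x y hl hm0 hmr1 hmpos
  have hQ := fun i => (PG_QQ hl (aw_pg (r := r) β s t mv p q x y) s i).eg
  have hE : ∀ i, EG (fun ω => nst mv (zt β s t mv p q x y) (QQ (aw β s t mv p q x y) s i) k1 ω
        / zt (r := r) β s t mv p q x y k1 ω) := by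
    intro i
    simp only [div_eq_mul_inv]
    exact (H.nst_eg (hQ i) k1 hk).mul (H.pg k1 hk).inv.eg
  let f : (Fin m → Fin n → ℝ) → (Fin (r+1) → Us m n) → ℝ := fun G U =>
      PhiUpToR r 1 β s t mv p q x y 1 k1 (gam0R r 1 β s t mv p q x y i.1 i.2) G U *
        PhiUpToR r 1 β s t mv p q x y 1 k1 (gam0R r 1 β s t mv p q x y i'.1 i'.2) G U
  have hf : ∀ ω : Om r m n, PhiUpToR r 1 β s t mv p q x y (k1+1) k1 f ω.1 ω.2
      = (nst mv (zt β s t mv p q x y) (QQ (aw β s t mv p q x y) s i) k1 ω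
        / zt β s t mv p q x y k1 ω) * (nst mv (zt β s t mv p q x y)
          (QQ (aw β s t mv p q x y) s i') k1 ω / zt β s t mv p q x y k1 ω) := by
    intro ω
    rw [phi_lt β s t mv p q x y (k1+1) f k1 (by omega)]
    simp only [f]
    rw [gam_eq β s t mv p q x y hl hm0 hmr1 hmpos i k1 hk ω,
      gam_eq β s t mv p q x y hl hm0 hmr1 hmpos i' k1 hk ω]
  have h0 : EG (fun ω : Om r m n => PhiUpToR r 1 β s t mv p q x y (k1+1) k1 f ω.1 ω.2) := by
    simp only [hf]
    exact (hE i).mul (hE i')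
  obtain ⟨h1, h2⟩ := H.phi_int (v := k1)
    (F := fun v ω => PhiUpToR r 1 β s t mv p q x y (k1+1) v f ω.1 ω.2) h0
    (fun w hw hkw ω => phi_succ β s t mv p q x y (k1+1) f w hw (by omega) ω) r hk le_rfl
  refine ⟨h1, ?_⟩
  rw [H.int_nst (hQ i) (hE i') k1 hk (fun w hw h' =>
    (H.nst_ind _ k1 hk w hw h').comp2 (H.ind k1 hk w hw h') (fun a b => a / b))]
  have e1 : ∀ ω : Om r m n, Pt mv (zt β s t mv p q x y) k1 ω *
      nst mv (zt β s t mv p q x y) (QQ (aw β s t mv p q x y) s i) k1 ω *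
      (nst mv (zt β s t mv p q x y) (QQ (aw β s t mv p q x y) s i') k1 ω
        / zt β s t mv p q x y k1 ω) = Pt mv (zt β s t mv p q x y) k1 ω *
        (zt β s t mv p q x y k1 ω * PhiUpToR r 1 β s t mv p q x y (k1+1) k1 f ω.1 ω.2) := by
    intro ω
    rw [hf]
    have := ((H.pg k1 hk).pos ω).ne'
    field_simp
  simp only [e1]
  rw [h2]
  congr 1
  funext ω
  rw [H.Pt_last, ← mul_assoc, inv_mul_cancel₀ ((H.pg r le_rfl).pos ω).ne', one_mul]
  rfl

lemma TpR_eq (hl : 1 ≤ l) (hm0 : mv 0 = 1) (hmr1 : mv (r+1) = 0)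
    (hmpos : ∀ k, 1 ≤ k → k ≤ r → 0 < mv k) (k : ℕ) (hk : k < r + 1) (j : Fin m)
    (i : Fin l × Fin l) :
    TpR r 1 β s t mv p q x y (k+1) j i.1 i.2
      = Real.sqrt (p k - p (k+1)) * (y i.2 j *
        (∫ ω : Om r m n, Pt mv (zt β s t mv p q x y) 0 ω * EE (aw β s t mv p q x y) s
            (fun i1 i2 => β * Real.sqrt (1 - t) * nrm2 (x i1) * y i2 j) i ω ∂muAll r m n
        + s * ∑ v ∈ Finset.range (k+1), (mv (v+1) - mv v) * ∑ i' : Fin l × Fin l,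
          (β * Real.sqrt (1 - t) * nrm2 (x i'.1) * y i'.2 j) *
          ∫ ω, gamR r 1 β s t mv p q x y v i.1 i.2 i'.1 i'.2 ω.1 ω.2 ∂muAll r m n)) := by
  have H := zt_chain (r := r) β s t mv p q x y hl hm0 hmr1 hmpos
  have hA := aw_pg (r := r) β s t mv p q x y
  have hT := H.T_formula hl hA s (zt_zero β s t mv p q x y) (k := ⟨k, hk⟩) (j := j)
    (b := Real.sqrt (p k - p (k+1)))
    (κ := fun i1 i2 => β * Real.sqrt (1 - t) * nrm2 (x i1) * y i2 j)
    (fun i1 i2 => aw_dd β s t mv p q x y i1 i2 ⟨k, hk⟩ j) i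
  have hu : ∀ U : Fin (r+1) → Us m n, u2c U (k+1) j = (U ⟨k, hk⟩).2.1 j := by
    intro U
    unfold u2c
    rw [dif_pos (show k + 1 - 1 < r + 1 by simpa using hk)]
    rfl
  have hg : EG (fun ω : Om r m n => CR r 1 β s t mv p q x y ω.1 ω.2 i.1 ^ (s - 1) *
          AR r 1 β s t mv p q x y ω.1 ω.2 i.1 i.2 * y i.2 j * u2c ω.2 (k+1) j) := by
    simp only [hu]
    exact ((PG_QQ hl hA s i).eg.mul (EG.const _)).mul (EG.cf ⟨k, hk⟩ j)
  have e1 : TpR r 1 β s t mv p q x y (k+1) j i.1 i.2 = y i.2 j *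
      ∫ ω, Pt mv (zt β s t mv p q x y) 0 ω *
        (QQ (aw β s t mv p q x y) s i ω * cf ⟨k, hk⟩ j ω) ∂muAll r m n := by
    unfold TpR
    simp only [nestR_eq]
    have := H.int_nst_last hg
    refine this.trans ?_
    rw [← integral_const_mul]
    congr 1
    funext ω
    simp only [hu, QQ, cf, CR, aw]
    ring
  rw [e1, hT, mul_left_comm]
  congr 3
  congr 1
  refine Finset.sum_congr rfl fun v hv => ?_
  have hv : v < k + 1 := Finset.mem_range.1 hv
  congr 1
  refine Finset.sum_congr rfl fun i' _ => ?_
  rw [(gamR_int β s t mv p q x y hl hm0 hmr1 hmpos i i' v (by omega)).2]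

lemma EBrR_eq (hl : 1 ≤ l) (hm0 : mv 0 = 1) (hmr1 : mv (r+1) = 0)
    (hmpos : ∀ k, 1 ≤ k → k ≤ r → 0 < mv k) (k1 : ℕ) (hk : k1 ≤ r)
    (f : Fin l → Fin l → Fin l → Fin l → ℝ) :
    EBrR r 1 β s t mv p q x y k1 f = ∑ i : Fin l × Fin l, ∑ i' : Fin l × Fin l,
      f i.1 i.2 i'.1 i'.2 *
        ∫ ω, gamR r 1 β s t mv p q x y k1 i.1 i.2 i'.1 i'.2 ω.1 ω.2 ∂muAll r m n := by
  unfold EBrR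
  have hE := fun i i' => (gamR_int (r := r) β s t mv p q x y hl hm0 hmr1 hmpos i i' k1 hk).1
  have e : ∀ ω : Om r m n, (∑ i1, ∑ i2, ∑ pp1, ∑ pp2,
      f i1 i2 pp1 pp2 * gamR r 1 β s t mv p q x y k1 i1 i2 pp1 pp2 ω.1 ω.2)
      = ∑ i : Fin l × Fin l, ∑ i' : Fin l × Fin l, f i.1 i.2 i'.1 i'.2 *
        gamR r 1 β s t mv p q x y k1 i.1 i.2 i'.1 i'.2 ω.1 ω.2 := by
    intro ω
    simp only [Fintype.sum_prod_type]
  simp only [e]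
  rw [integral_finsetSum]
  · refine Finset.sum_congr rfl fun i _ => ?_
    rw [integral_finsetSum]
    · simp only [integral_const_mul]
    · exact fun i' _ => ((EG.const _).mul (hE i i')).integrable
  · exact fun i _ => (EG.sum _ fun i' _ => (EG.const _).mul (hE i i')).integrable

end concrete

/-- `r`-th level scaled-cancellation recursion for the sequence `T^p_{k,1,j}`. -/
theorem rth_level_recursion_Tp
    (r m n l : ℕ) (hr : 1 ≤ r) (hm : 1 ≤ m) (hn : 1 ≤ n) (hl : 1 ≤ l)
    (β s t : ℝ) (hβ : 0 < β) (hs : s ≠ 0) (ht : t ∈ Set.Ioo (0:ℝ) 1)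
    (mv p q : ℕ → ℝ)
    (hm0 : mv 0 = 1) (hmr1 : mv (r+1) = 0) (hmpos : ∀ k, 1 ≤ k → k ≤ r → 0 < mv k)
    (hp0 : p 0 ≤ 1) (hpmono : ∀ k ≤ r, p (k+1) ≤ p k) (hpend : p (r+1) = 0)
    (hq0 : q 0 ≤ 1) (hqmono : ∀ k ≤ r, q (k+1) ≤ q k) (hqend : q (r+1) = 0)
    (x : Fin l → Fin n → ℝ) (y : Fin l → Fin m → ℝ)
    (hx : ∀ i, x i ≠ 0) (hy : ∀ i, y i ≠ 0)
    (hpstrict : ∀ k < r, p (k+1) < p k) (hprpos : 0 < p r) :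
    ∀ k1, 1 ≤ k1 → k1 ≤ r →
      (∑ i1, ∑ i2, ∑ j, β * nrm2 (x i1) *
          (Real.sqrt (1 - t) / Real.sqrt (p k1 - p (k1+1)) * TpR r 1 β s t mv p q x y (k1+1) j i1 i2))
        = (∑ i1, ∑ i2, ∑ j, β * nrm2 (x i1) *
            (Real.sqrt (1 - t) / Real.sqrt (p (k1-1) - p k1) * TpR r 1 β s t mv p q x y k1 j i1 i2))
          - (1 - t) * s * β ^ 2 * (mv k1 - mv (k1+1)) * EBrR r 1 β s t mv p q x y k1 (fun i1 i2 pp1 pp2 => nrm2 (x i1) * nrm2 (x pp1) * dotv (y pp2) (y i2)) := by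
  intro k1 hk1 hk1r
  obtain ⟨k, rfl⟩ : ∃ k, k1 = k + 1 := ⟨k1 - 1, by omega⟩
  have hb1 : Real.sqrt (p (k+1) - p (k+1+1)) ≠ 0 := by
    refine (Real.sqrt_pos.2 ?_).ne'
    rcases Nat.lt_or_ge (k+1) r with h | h
    · linarith [hpstrict (k+1) h]
    · have : k + 1 = r := by omega
      rw [this, hpend]
      linarith
  have hb0 : Real.sqrt (p k - p (k+1)) ≠ 0 :=
    (Real.sqrt_pos.2 (by linarith [hpstrict k (by omega)])).ne'
  have hS : Real.sqrt (1 - t) * Real.sqrt (1 - t) = 1 - t :=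
    Real.mul_self_sqrt (by linarith [ht.2])
  rw [EBrR_eq β s t mv p q x y hl hm0 hmr1 hmpos (k+1) hk1r, Nat.add_sub_cancel]
  have hT1 := fun i1 i2 j => TpR_eq β s t mv p q x y hl hm0 hmr1 hmpos (k+1) (by omega) j (i1, i2)
  have hT0 := fun i1 i2 j => TpR_eq β s t mv p q x y hl hm0 hmr1 hmpos k (by omega) j (i1, i2)
  simp only at hT1 hT0
  rw [eq_sub_iff_add_eq, ← eq_sub_iff_add_eq']
  simp only [← Finset.sum_sub_distrib, Fintype.sum_prod_type (γ := ℝ), Finset.mul_sum]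
  refine Finset.sum_congr rfl fun i1 _ => Finset.sum_congr rfl fun i2 _ => ?_
  have hterm : ∀ j, β * nrm2 (x i1) * (Real.sqrt (1 - t) / Real.sqrt (p k - p (k+1)) *
        TpR r 1 β s t mv p q x y (k+1) j i1 i2)
      - β * nrm2 (x i1) * (Real.sqrt (1 - t) / Real.sqrt (p (k+1) - p (k+1+1)) *
        TpR r 1 β s t mv p q x y (k+1+1) j i1 i2)
      = ∑ a1, ∑ a2, (1 - t) * s * β ^ 2 * (mv (k+1) - mv (k+1+1)) *
        (nrm2 (x i1) * nrm2 (x a1) * (y a2 j * y i2 j) *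
        ∫ ω, gamR r 1 β s t mv p q x y (k+1) i1 i2 a1 a2 ω.1 ω.2 ∂muAll r m n) := by
    intro j
    have e : ∀ b X : ℝ, b ≠ 0 → β * nrm2 (x i1) * (Real.sqrt (1 - t) / b * (b * X))
        = β * nrm2 (x i1) * (Real.sqrt (1 - t) * X) := by
      intro b X hb
      field_simp
    rw [hT1, hT0, e _ _ hb1, e _ _ hb0, Finset.sum_range_succ _ (k+1)]
    have e2 : ∀ a b c d f g : ℝ, a * (b * (c * (d + s * f))) - a * (b * (c * (d + s * (f + g))))
        = -(a * b * c * s * g) := fun a b c d f g => by ring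
    rw [e2, Fintype.sum_prod_type, ← mul_assoc, ← neg_mul, Finset.mul_sum]
    refine Finset.sum_congr rfl fun a1 _ => ?_
    rw [Finset.mul_sum]
    refine Finset.sum_congr rfl fun a2 _ => ?_
    linear_combination (s * β ^ 2 * (mv (k+1) - mv (k+1+1)) *
        (nrm2 (x i1) * nrm2 (x a1) * (y a2 j * y i2 j) *
        ∫ ω, gamR r 1 β s t mv p q x y (k+1) i1 i2 a1 a2 ω.1 ω.2 ∂muAll r m n)) * hS
  simp only [hterm]
  symm
  rw [Finset.sum_comm]
  refine Finset.sum_congr rfl fun a1 _ => ?_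
  rw [Finset.sum_comm]
  refine Finset.sum_congr rfl fun a2 _ => ?_
  simp only [dotv, Finset.mul_sum, Finset.sum_mul]

end

end SFLR
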